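/- arXiv:1911.01749 — 8 statements merged into one kernel-verified Lean document; each statement's English description precedes it below -/
import Mathlib

section
/- For every positive integer n, the product of the unitary cyclotomic polynomials over the unitary divisors of n equals X^n − 1; that is, ∏_{d ∣∣ n} Φ*_d(X) = X^n − 1 in ℤ[X]. -/
open Polynomial

/-- The unitary cyclotomic polynomial `Φ*_n = ∏_{d ∣ n, rad(d) = rad(n)} Φ_d`. -/
noncomputable def unitaryCyclotomic (n : ℕ) : Polynomial ℤ :=
  ∏ d ∈ n.divisors.filter (fun d => d.primeFactors = n.primeFactors), cyclotomic d ℤ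

/-- If `m ∣ n` and every prime factor of `m` divides `e`, then `m` divides `e ^ n`. -/
lemma dvd_pow_of_primeFactors_subset {m n e : ℕ} (hn : n ≠ 0) (hmn : m ∣ n) (he : e ≠ 0)
    (h : m.primeFactors ⊆ e.primeFactors) : m ∣ e ^ n := by
  exact ((Nat.dvd_pow_self_iff (ne_zero_of_dvd_ne_zero hn hmn) he).mpr h).trans
    (pow_dvd_pow e (Nat.le_of_dvd (Nat.pos_of_ne_zero hn) hmn))

/-- The number `gcd n (e ^ n)` is a unitary divisor of `n`. -/
lemma coprime_gcd_pow_div {n : ℕ} (hn : n ≠ 0) (e : ℕ) :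
    (n.gcd (e ^ n)).Coprime (n / n.gcd (e ^ n)) := by
  refine Nat.coprime_of_dvd fun p hp hpg hpq => ?_
  have hpe : p ∣ e := hp.dvd_of_dvd_pow (hpg.trans (Nat.gcd_dvd_right _ _))
  have hpow : p ^ n.factorization p ∣ n.gcd (e ^ n) :=
    Nat.dvd_gcd (Nat.ordProj_dvd n p)
      ((pow_dvd_pow p (Nat.factorization_lt p hn).le).trans (pow_dvd_pow_of_dvd hpe n))
  refine Nat.pow_succ_factorization_not_dvd hn hp ?_
  rw [pow_succ]
  exact (mul_dvd_mul hpow hpq).trans (Nat.mul_div_cancel' (Nat.gcd_dvd_left n (e ^ n))).dvd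

/-- For `e ∣ n`, the number `gcd n (e ^ n)` has the same prime factors as `e`. -/
lemma primeFactors_gcd_pow {n e : ℕ} (hn : n ≠ 0) (he : e ∣ n) :
    (n.gcd (e ^ n)).primeFactors = e.primeFactors := by
  have he0 : e ≠ 0 := ne_zero_of_dvd_ne_zero hn he
  rw [Nat.primeFactors_gcd hn (pow_ne_zero n he0), Nat.primeFactors_pow e hn]
  exact Finset.inter_eq_right.mpr (Nat.primeFactors_mono he hn)

/-- A unitary divisor `d` of `n` is `gcd n (e ^ n)` for every `e` with the prime factors of `d`. -/
lemma gcd_pow_eq_of_primeFactors_eq {n d e : ℕ} (hn : n ≠ 0) (hd : d ∣ n) (he : e ≠ 0)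
    (hcop : d.Coprime (n / d)) (h : e.primeFactors = d.primeFactors) :
    n.gcd (e ^ n) = d := by
  have hd0 : d ≠ 0 := ne_zero_of_dvd_ne_zero hn hd
  have hq0 : n / d ≠ 0 := ne_zero_of_dvd_ne_zero hn (Nat.div_dvd_of_dvd hd)
  have hec : (e ^ n).Coprime (n / d) := by
    refine Nat.Coprime.pow_left n ?_
    rw [← Nat.disjoint_primeFactors he hq0, h, Nat.disjoint_primeFactors hd0 hq0]
    exact hcop
  refine Nat.dvd_antisymm ?_ (Nat.dvd_gcd hd (dvd_pow_of_primeFactors_subset hn hd he h.ge))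
  refine (hec.coprime_dvd_left (Nat.gcd_dvd_right n (e ^ n))).dvd_of_dvd_mul_right ?_
  rw [Nat.mul_div_cancel' hd]
  exact Nat.gcd_dvd_left n (e ^ n)

/-- `∏_{d ∣∣ n} Φ*_d(X) = X^n − 1` in `ℤ[X]`. -/
theorem prod_unitaryCyclotomic_eq (n : ℕ) (hn : 0 < n) :
    ∏ d ∈ n.divisors.filter (fun d => Nat.Coprime d (n / d)), unitaryCyclotomic d =
      X ^ n - 1 := by
  have hn0 : n ≠ 0 := hn.ne'
  rw [← prod_cyclotomic_eq_X_pow_sub_one hn ℤ]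
  have hmaps : ∀ e ∈ n.divisors,
      n.gcd (e ^ n) ∈ n.divisors.filter (fun d => Nat.Coprime d (n / d)) := fun e _ =>
    Finset.mem_filter.mpr ⟨Nat.mem_divisors.mpr ⟨Nat.gcd_dvd_left _ _, hn0⟩,
      coprime_gcd_pow_div hn0 e⟩
  rw [← Finset.prod_fiberwise_of_maps_to hmaps]
  refine Finset.prod_congr rfl fun d hd => ?_
  rw [Finset.mem_filter, Nat.mem_divisors] at hd
  obtain ⟨⟨hdn, -⟩, hcop⟩ := hd
  unfold unitaryCyclotomic
  congr 1
  ext e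
  simp only [Finset.mem_filter, Nat.mem_divisors]
  constructor
  · rintro ⟨⟨hed, hd0⟩, hpf⟩
    exact ⟨⟨hed.trans hdn, hn0⟩,
      gcd_pow_eq_of_primeFactors_eq hn0 hdn (ne_zero_of_dvd_ne_zero hd0 hed) hcop hpf⟩
  · rintro ⟨⟨hen, -⟩, rfl⟩
    exact ⟨⟨Nat.dvd_gcd hen (dvd_pow_self e hn0), ne_zero_of_dvd_ne_zero hn0 hdn⟩,
      (primeFactors_gcd_pow hn0 hen).symm⟩
end

section
/- For every positive integer n, Φ*_n(X) · ∏_{d ∣∣ n, μ*(n/d) = −1} (X^d − 1) = ∏_{d ∣∣ n, μ*(n/d) = 1} (X^d − 1) in ℤ[X], where μ*(k) = (−1)^{ω(k)} and ω(k) is the number of distinct prime factors of k. -/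
open Polynomial

/-- The unitary Möbius function `μ*(k) = (−1)^{ω(k)}`. -/
def unitaryMoebius (k : ℕ) : ℤ := (-1) ^ k.primeFactors.card

/-- The product of the full `p`-parts of `n` over the primes `p ∈ T`. -/
def primesPart (n : ℕ) (T : Finset ℕ) : ℕ := ∏ p ∈ T, p ^ n.factorization p

theorem primeFactors_primesPart {n : ℕ} {T : Finset ℕ} (hT : T ⊆ n.primeFactors) :
    (primesPart n T).primeFactors = T := by
  have hne : ∀ p ∈ T, p ^ n.factorization p ≠ 0 := fun p hp =>
    pow_ne_zero _ (Nat.prime_of_mem_primeFactors (hT hp)).ne_zero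
  ext q
  rw [primesPart, Nat.mem_primeFactors_of_ne_zero (Finset.prod_ne_zero_iff.2 hne)]
  constructor
  · rintro ⟨hq, hdvd⟩
    obtain ⟨p, hp, hqp⟩ := (hq.prime.dvd_finsetProd_iff _).1 hdvd
    rwa [(Nat.prime_dvd_prime_iff_eq hq (Nat.prime_of_mem_primeFactors (hT hp))).1
      (hq.dvd_of_dvd_pow hqp)]
  · intro hq
    refine ⟨Nat.prime_of_mem_primeFactors (hT hq), (dvd_pow_self q ?_).trans
      (Finset.dvd_prod_of_mem (fun p => p ^ n.factorization p) hq)⟩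
    exact Finsupp.mem_support_iff.1 (by simpa using hT hq)

theorem primesPart_ne_zero {n : ℕ} {T : Finset ℕ} (hT : T ⊆ n.primeFactors) :
    primesPart n T ≠ 0 :=
  Finset.prod_ne_zero_iff.2 fun _ hp =>
    pow_ne_zero _ (Nat.prime_of_mem_primeFactors (hT hp)).ne_zero

theorem primesPart_sdiff_mul_primesPart {n : ℕ} (hn : n ≠ 0) {T : Finset ℕ}
    (hT : T ⊆ n.primeFactors) :
    primesPart n (n.primeFactors \ T) * primesPart n T = n :=
  (Finset.prod_sdiff hT).trans (Nat.prod_factorization_pow_eq_self hn)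

/-- A unitary divisor of `n` is determined by its prime factors. -/
theorem primesPart_primeFactors_of_coprime {d k : ℕ} (hk : k ≠ 0) (h : d.Coprime k) :
    primesPart (d * k) k.primeFactors = k := by
  conv_rhs => rw [← Nat.prod_factorization_pow_eq_self hk]
  refine Finset.prod_congr rfl fun p hp => ?_
  rw [Nat.factorization_eq_of_coprime_right h (by simpa using hp)]

theorem sum_unitaryMoebius_of_dvd {n e : ℕ} (hn : n ≠ 0) (he : e ∣ n) :
    ∑ d ∈ n.divisors.filter (fun d => d.Coprime (n / d) ∧ e ∣ d), unitaryMoebius (n / d) =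
      if e.primeFactors = n.primeFactors then 1 else 0 := by
  have he0 : e ≠ 0 := ne_zero_of_dvd_ne_zero hn he
  have hsub : e.primeFactors ⊆ n.primeFactors := Nat.primeFactors_mono he hn
  trans ∑ T ∈ (n.primeFactors \ e.primeFactors).powerset, (-1 : ℤ) ^ T.card
  · refine Finset.sum_bij (fun d _ => (n / d).primeFactors) ?_ ?_ ?_ fun _ _ => rfl
    · intro d hd
      simp only [Finset.mem_filter, Nat.mem_divisors] at hd
      obtain ⟨⟨hdn, -⟩, hcop, hed⟩ := hd
      exact Finset.mem_powerset.2 <| Finset.subset_sdiff.2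
        ⟨Nat.primeFactors_mono (Nat.div_dvd_of_dvd hdn) hn,
          (hcop.coprime_dvd_left hed).symm.disjoint_primeFactors⟩
    · intro a ha b hb hab
      simp only [Finset.mem_filter, Nat.mem_divisors] at ha hb
      have key : ∀ d, d ∣ n → d.Coprime (n / d) →
          primesPart n (n / d).primeFactors = n / d := by
        intro d hdn hcop
        have := primesPart_primeFactors_of_coprime
          (Nat.div_ne_zero_iff_of_dvd hdn |>.2 ⟨hn, ne_zero_of_dvd_ne_zero hn hdn⟩) hcop
        rwa [Nat.mul_div_cancel' hdn] at this
      have hdiv : n / a = n / b := by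
        rw [← key a ha.1.1 ha.2.1, ← key b hb.1.1 hb.2.1, hab]
      rw [← Nat.div_div_self ha.1.1 hn, hdiv, Nat.div_div_self hb.1.1 hn]
    · intro T hT
      obtain ⟨hTn, hTe⟩ := Finset.subset_sdiff.1 (Finset.mem_powerset.1 hT)
      have hmul := primesPart_sdiff_mul_primesPart hn hTn
      have hd0 := primesPart_ne_zero (n := n) (T := n.primeFactors \ T) Finset.sdiff_subset
      have hdiv : n / primesPart n (n.primeFactors \ T) = primesPart n T :=
        Nat.div_eq_of_eq_mul_right (Nat.pos_of_ne_zero hd0) hmul.symm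
      refine ⟨primesPart n (n.primeFactors \ T), ?_, ?_⟩
      · rw [Finset.mem_filter, Nat.mem_divisors, hdiv]
        refine ⟨⟨⟨_, hmul.symm⟩, hn⟩, ?_, ?_⟩
        · rw [← Nat.disjoint_primeFactors hd0 (primesPart_ne_zero hTn),
            primeFactors_primesPart Finset.sdiff_subset, primeFactors_primesPart hTn]
          exact Finset.sdiff_disjoint
        · refine Nat.Coprime.dvd_of_dvd_mul_right (n := primesPart n T) ?_ (by rwa [hmul])
          rw [← Nat.disjoint_primeFactors he0 (primesPart_ne_zero hTn),
            primeFactors_primesPart hTn]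
          exact hTe.symm
      · simp only [hdiv, primeFactors_primesPart hTn]
  · rw [Finset.sum_powerset_neg_one_pow_card]
    refine if_congr ?_ rfl rfl
    rw [Finset.sdiff_eq_empty_iff_subset]
    exact ⟨hsub.antisymm, fun h => h.ge⟩

theorem card_unitaryMoebius_eq {n e : ℕ} (hn : n ≠ 0) (he : e ∣ n) :
    (if e.primeFactors = n.primeFactors then 1 else 0) +
      ((n.divisors.filter
        (fun d => d.Coprime (n / d) ∧ unitaryMoebius (n / d) = -1)).filter (e ∣ ·)).card =
      ((n.divisors.filter
        (fun d => d.Coprime (n / d) ∧ unitaryMoebius (n / d) = 1)).filter (e ∣ ·)).card := by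
  have hcard : ∀ ε : ℤ, (((n.divisors.filter
      (fun d => d.Coprime (n / d) ∧ unitaryMoebius (n / d) = ε)).filter (e ∣ ·)).card : ℤ) =
      ∑ d ∈ n.divisors.filter (fun d => d.Coprime (n / d) ∧ e ∣ d),
        if unitaryMoebius (n / d) = ε then 1 else 0 := by
    intro ε
    rw [Finset.sum_boole, Finset.filter_filter, Finset.filter_filter]
    simp only [and_right_comm]
  have hsplit : ∀ k : ℕ, unitaryMoebius k + (if unitaryMoebius k = -1 then 1 else 0) =
      if unitaryMoebius k = 1 then 1 else 0 := by
    intro k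
    rcases neg_one_pow_eq_or ℤ k.primeFactors.card with h | h <;> simp [unitaryMoebius, h]
  rw [← Nat.cast_inj (R := ℤ), Nat.cast_add, Nat.cast_ite, Nat.cast_one, Nat.cast_zero,
    hcard, hcard, ← sum_unitaryMoebius_of_dvd hn he, ← Finset.sum_add_distrib]
  exact Finset.sum_congr rfl fun d _ => hsplit _

theorem prod_X_pow_sub_one_eq_prod_cyclotomic {n : ℕ} {A : Finset ℕ} (hA : A ⊆ n.divisors) :
    ∏ d ∈ A, (X ^ d - 1 : ℤ[X]) =
      ∏ e ∈ n.divisors, cyclotomic e ℤ ^ (A.filter (e ∣ ·)).card := by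
  have hexp : ∀ d ∈ A, (X ^ d - 1 : ℤ[X]) =
      ∏ e ∈ n.divisors, if e ∣ d then cyclotomic e ℤ else 1 := by
    intro d hd
    have hdn := Nat.mem_divisors.1 (hA hd)
    rw [← prod_cyclotomic_eq_X_pow_sub_one (Nat.pos_of_mem_divisors (hA hd)) ℤ,
      ← Finset.prod_filter, Nat.divisors_filter_dvd_of_dvd hdn.2 hdn.1]
  rw [Finset.prod_congr rfl hexp, Finset.prod_comm]
  refine Finset.prod_congr rfl fun e _ => ?_
  rw [← Finset.prod_filter, Finset.prod_const]

/-- `Φ*_n(X) · ∏_{d ∣∣ n, μ*(n/d) = −1} (X^d − 1) = ∏_{d ∣∣ n, μ*(n/d) = 1} (X^d − 1)`. -/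
theorem unitaryCyclotomic_mul_prod (n : ℕ) (hn : 0 < n) :
    unitaryCyclotomic n *
      ∏ d ∈ n.divisors.filter
        (fun d => Nat.Coprime d (n / d) ∧ unitaryMoebius (n / d) = -1),
        (X ^ d - 1) =
    ∏ d ∈ n.divisors.filter
        (fun d => Nat.Coprime d (n / d) ∧ unitaryMoebius (n / d) = 1),
        (X ^ d - 1) := by
  rw [prod_X_pow_sub_one_eq_prod_cyclotomic (Finset.filter_subset _ _),
    prod_X_pow_sub_one_eq_prod_cyclotomic (Finset.filter_subset _ _),
    unitaryCyclotomic, Finset.prod_filter, ← Finset.prod_mul_distrib]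
  refine Finset.prod_congr rfl fun e he => ?_
  rw [← card_unitaryMoebius_eq hn.ne' (Nat.dvd_of_mem_divisors he), pow_add, pow_ite, pow_one,
    pow_zero]
end

section
/- Let m ≥ 1 be a fixed positive integer. For every integer t there exist a positive integer n and a natural number j such that the coefficient of X^j in Φ*_{mn} equals t. In other words, {a*_{mn}(j) : n ≥ 1, j ≥ 0} = ℤ, where a*_k(j) denotes the coefficient of X^j in Φ*_k. -/
open Polynomial

/-- Telescoping of the expansion identities for cyclotomic polynomials along powers of `p`. -/
theorem prod_cyclotomic_mul_prime_pow_mul {p d : ℕ} (hp : p.Prime) (hd : ¬p ∣ d) (a : ℕ) :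
    (∏ b ∈ Finset.range a, cyclotomic (d * p ^ (b + 1)) ℤ) * cyclotomic d ℤ =
      expand ℤ (p ^ a) (cyclotomic d ℤ) := by
  induction a with
  | zero => simp
  | succ a ih =>
    rw [pow_succ', ← expand_expand, ← ih, map_mul, map_prod,
      cyclotomic_expand_eq_cyclotomic_mul hp hd, Finset.prod_range_succ', ← mul_assoc]
    congr 2
    · refine Finset.prod_congr rfl fun b _ => ?_
      rw [cyclotomic_expand_eq_cyclotomic hp (Dvd.intro_left (d * p ^ b) (by ring)), mul_assoc,
        ← pow_succ]
    · simp

theorem unitaryCyclotomic_mul_prime_pow {n p a : ℕ} (hn : n ≠ 0) (hp : p.Prime) (hpn : ¬p ∣ n)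
    (ha : a ≠ 0) :
    unitaryCyclotomic (n * p ^ a) * unitaryCyclotomic n =
      expand ℤ (p ^ a) (unitaryCyclotomic n) := by
  have key : unitaryCyclotomic (n * p ^ a) =
      ∏ d ∈ n.divisors.filter (fun d => d.primeFactors = n.primeFactors),
        ∏ b ∈ Finset.range a, cyclotomic (d * p ^ (b + 1)) ℤ := by
    rw [unitaryCyclotomic, ← Finset.prod_product']
    symm
    have hpp : p ^ a ≠ 0 := pow_ne_zero _ hp.ne_zero
    have hpf : (n * p ^ a).primeFactors = insert p n.primeFactors := by
      rw [Nat.primeFactors_mul hn hpp, Nat.primeFactors_prime_pow ha hp, Finset.union_comm,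
        Finset.insert_eq]
    refine Finset.prod_nbij (fun x => x.1 * p ^ (x.2 + 1)) ?_ ?_ ?_ (fun _ _ => rfl)
    · rintro ⟨d, b⟩ h
      simp only [Finset.mem_product, Finset.mem_filter, Nat.mem_divisors, Finset.mem_range] at h ⊢
      obtain ⟨⟨⟨hdn, -⟩, hdp⟩, hb⟩ := h
      refine ⟨⟨Nat.mul_dvd_mul hdn (pow_dvd_pow _ hb), mul_ne_zero hn hpp⟩, ?_⟩
      rw [hpf, Nat.primeFactors_mul (ne_zero_of_dvd_ne_zero hn hdn) (pow_ne_zero _ hp.ne_zero),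
        Nat.primeFactors_prime_pow (Nat.succ_ne_zero b) hp, Finset.union_comm, hdp,
        Finset.insert_eq]
    · rintro ⟨d, b⟩ h ⟨d', b'⟩ h' heq
      simp only [Finset.coe_product, Set.mem_prod, Finset.mem_coe, Finset.mem_filter,
        Nat.mem_divisors] at h h'
      have h1 : ¬p ∣ d := fun h1 => hpn (h1.trans h.1.1.1)
      have h2 : ¬p ∣ d' := fun h1 => hpn (h1.trans h'.1.1.1)
      have hb : b = b' := by
        have := congrArg (fun x => x.factorization p) heq
        simp only at this
        rw [Nat.factorization_mul (ne_zero_of_dvd_ne_zero hn h.1.1.1) (pow_ne_zero _ hp.ne_zero),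
          Nat.factorization_mul (ne_zero_of_dvd_ne_zero hn h'.1.1.1) (pow_ne_zero _ hp.ne_zero)]
          at this
        simpa [Nat.factorization_eq_zero_of_not_dvd, h1, h2, hp.factorization_self] using this
      subst hb
      exact Prod.ext (Nat.eq_of_mul_eq_mul_right (pow_pos hp.pos _) heq) rfl
    · intro x hx
      simp only [Finset.coe_filter, Nat.mem_divisors, Set.mem_ofPred_eq] at hx
      obtain ⟨⟨hx1, -⟩, hx2⟩ := hx
      obtain ⟨d, e, hd, he, rfl⟩ := (Nat.dvd_mul).1 hx1
      obtain ⟨b, hb, rfl⟩ := (Nat.dvd_prime_pow hp).1 he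
      have hd0 : d ≠ 0 := ne_zero_of_dvd_ne_zero hn hd
      have hpd : ¬p ∣ d := fun h1 => hpn (h1.trans hd)
      rw [hpf] at hx2
      have hb0 : b ≠ 0 := by
        rintro rfl
        rw [pow_zero, mul_one] at hx2
        exact hpd (Nat.dvd_of_mem_primeFactors (hx2 ▸ Finset.mem_insert_self p _))
      obtain ⟨b, rfl⟩ := Nat.exists_eq_succ_of_ne_zero hb0
      rw [Nat.primeFactors_mul hd0 (pow_ne_zero _ hp.ne_zero), Nat.primeFactors_prime_pow hb0 hp,
        Finset.union_comm, ← Finset.insert_eq] at hx2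
      refine ⟨(d, b), ?_, rfl⟩
      simp only [Finset.coe_product, Set.mem_prod, Finset.mem_coe, Finset.mem_filter,
        Nat.mem_divisors, Finset.mem_range]
      refine ⟨⟨⟨hd, hn⟩, ?_⟩, hb⟩
      rw [← Finset.erase_insert (a := p) (s := d.primeFactors)
          (fun h => hpd (Nat.dvd_of_mem_primeFactors h)), hx2,
        Finset.erase_insert (fun h => hpn (Nat.dvd_of_mem_primeFactors h))]
  rw [key, unitaryCyclotomic, ← Finset.prod_mul_distrib, map_prod]
  refine Finset.prod_congr rfl fun d hd => ?_
  rw [Finset.mem_filter, Nat.mem_divisors] at hd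
  exact prod_cyclotomic_mul_prime_pow_mul hp (fun h => hpn (h.trans hd.1.1)) a

theorem unitaryCyclotomic_prime_mul_X_sub_one {p : ℕ} (hp : p.Prime) :
    unitaryCyclotomic p * (X - 1) = X ^ p - 1 := by
  have h1 : unitaryCyclotomic 1 = X - 1 := by simp [unitaryCyclotomic, Finset.filter_singleton]
  have := unitaryCyclotomic_mul_prime_pow one_ne_zero hp hp.not_dvd_one one_ne_zero
  simpa [h1] using this

theorem unitaryCyclotomic_coeff_zero {n : ℕ} (hn : 1 < n) :
    (unitaryCyclotomic n).coeff 0 = 1 := by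
  rw [unitaryCyclotomic, ← constantCoeff_apply, map_prod]
  refine Finset.prod_eq_one fun d hd => ?_
  rw [Finset.mem_filter, Nat.mem_divisors] at hd
  refine cyclotomic_coeff_zero ℤ ?_
  obtain ⟨q, hq⟩ := Nat.nonempty_primeFactors.2 hn
  rw [← hd.2] at hq
  exact Nat.nonempty_primeFactors.1 ⟨q, hq⟩

theorem X_pow_dvd_expand_sub {f : ℤ[X]} (hf : f.coeff 0 = 1) {B q : ℕ} (hq : 0 < q)
    (hB : B ≤ 2 * q) : X ^ B ∣ expand ℤ q f - (1 + C (f.coeff 1) * X ^ q) := by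
  rw [X_pow_dvd_iff]
  intro k hk
  rw [coeff_sub, coeff_expand hq, coeff_add, coeff_C_mul, coeff_X_pow, coeff_one]
  split_ifs with h h1 h2 h2 h1 h2 h2
  · omega
  · simp [h1, hf]
  · simp [h2, Nat.div_self hq]
  · obtain ⟨c, rfl⟩ := h
    have : c < 2 := by
      by_contra! hc
      have := Nat.mul_le_mul_left q hc
      omega
    interval_cases c <;> simp_all
  all_goals simp_all

theorem X_pow_dvd_expand_sub_one {f : ℤ[X]} (hf : f.coeff 0 = 1) {B q : ℕ} (hq : 0 < q)
    (hB : B ≤ q) : X ^ B ∣ expand ℤ q f - 1 := by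
  have h := X_pow_dvd_expand_sub hf hq (by omega : B ≤ 2 * q)
  have h2 : X ^ B ∣ C (f.coeff 1) * X ^ q := Dvd.dvd.mul_left (pow_dvd_pow X hB) _
  have h3 := dvd_add h h2
  ring_nf at h3 ⊢
  exact h3

/-- Adjoining prime powers `p ^ a ≥ B` to `n` alternately inverts `Φ*_n` modulo `X ^ B`. -/
theorem unitaryCyclotomic_mul_prod_prime_pow {n B a : ℕ} (hn : 1 < n) (ha : a ≠ 0)
    (hB : B ≤ 2 ^ a) (S : Finset ℕ) (hS : ∀ p ∈ S, p.Prime ∧ ¬p ∣ n) :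
    (Even S.card → X ^ B ∣ unitaryCyclotomic (n * ∏ p ∈ S, p ^ a) - unitaryCyclotomic n) ∧
    (Odd S.card → X ^ B ∣ unitaryCyclotomic (n * ∏ p ∈ S, p ^ a) * unitaryCyclotomic n - 1) := by
  induction S using Finset.induction_on with
  | empty => simp
  | insert p S hpS ih =>
    have ih := ih fun q hq => hS q (Finset.mem_insert_of_mem hq)
    obtain ⟨hp, hpn⟩ := hS p (Finset.mem_insert_self _ _)
    set N := n * ∏ q ∈ S, q ^ a with hN
    have hprod : ∏ q ∈ S, q ^ a ≠ 0 := Finset.prod_ne_zero_iff.2 fun q hq =>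
      pow_ne_zero _ (hS q (Finset.mem_insert_of_mem hq)).1.ne_zero
    have hN1 : 1 < N := hn.trans_le (Nat.le_mul_of_pos_right _ (Nat.pos_of_ne_zero hprod))
    have hpN : ¬p ∣ N := by
      rw [hN, hp.dvd_mul, not_or]
      refine ⟨hpn, fun h => ?_⟩
      obtain ⟨q, hq, hpq⟩ := (hp.prime.dvd_finsetProd_iff _).1 h
      have := (Nat.prime_dvd_prime_iff_eq hp (hS q (Finset.mem_insert_of_mem hq)).1).1
        (hp.dvd_of_dvd_pow hpq)
      exact hpS (this ▸ hq)
    have hexp : n * ∏ q ∈ insert p S, q ^ a = N * p ^ a := by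
      rw [Finset.prod_insert hpS, hN]; ring
    have hrec := unitaryCyclotomic_mul_prime_pow (by omega) hp hpN ha
    obtain ⟨u, hu⟩ := X_pow_dvd_expand_sub_one (unitaryCyclotomic_coeff_zero hN1)
      (pow_pos hp.pos a) (hB.trans (Nat.pow_le_pow_left hp.two_le a))
    rw [← hrec] at hu
    rw [hexp, Finset.card_insert_of_notMem hpS, Nat.even_add_one, Nat.odd_add_one,
      Nat.not_even_iff_odd, Nat.not_odd_iff_even]
    generalize unitaryCyclotomic (N * p ^ a) = F at *
    constructor
    · intro h
      obtain ⟨v, hv⟩ := ih.2 h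
      exact ⟨unitaryCyclotomic n * u - F * v, by
        linear_combination unitaryCyclotomic n * hu - F * hv⟩
    · intro h
      obtain ⟨v, hv⟩ := ih.1 h
      exact ⟨u - F * v, by linear_combination hu - F * hv⟩

/-- The truncation modulo `X ^ B` of `Φ*_n`, where `n` is the product of a prime `p₀` with a set
of primes `p ≥ B / 2`. -/
theorem unitaryCyclotomic_prime_mul_prod {p₀ B : ℕ} (hp₀ : p₀.Prime) (P : Finset ℕ)
    (hP : ∀ p ∈ P, p.Prime ∧ p ≠ p₀ ∧ B ≤ 2 * p) :
    (Even P.card → (unitaryCyclotomic (p₀ * ∏ p ∈ P, p)).coeff 1 = 1 ∧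
      X ^ B ∣ unitaryCyclotomic (p₀ * ∏ p ∈ P, p) -
        unitaryCyclotomic p₀ * (1 - ∑ p ∈ P, X ^ p)) ∧
    (Odd P.card → (unitaryCyclotomic (p₀ * ∏ p ∈ P, p)).coeff 1 = -1 ∧
      X ^ B ∣ unitaryCyclotomic (p₀ * ∏ p ∈ P, p) * unitaryCyclotomic p₀ -
        (1 + ∑ p ∈ P, X ^ p)) := by
  induction P using Finset.induction_on with
  | empty =>
    suffices (unitaryCyclotomic p₀).coeff 1 = 1 by simpa
    have h := congrArg (fun f => coeff f 1) (unitaryCyclotomic_prime_mul_X_sub_one hp₀)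
    have h0 := unitaryCyclotomic_coeff_zero hp₀.one_lt
    simp only [mul_sub, mul_one, coeff_sub, coeff_X_pow, coeff_one] at h
    rw [coeff_mul_X, h0, if_neg hp₀.one_lt.ne] at h
    simp at h
    linarith
  | insert p S hpS ih =>
    have hS : ∀ q ∈ S, q.Prime ∧ q ≠ p₀ ∧ B ≤ 2 * q :=
      fun q hq => hP q (Finset.mem_insert_of_mem hq)
    have ih := ih hS
    obtain ⟨hp, hpp₀, hBp⟩ := hP p (Finset.mem_insert_self _ _)
    set N := p₀ * ∏ q ∈ S, q with hN
    have hprod : ∏ q ∈ S, q ≠ 0 := Finset.prod_ne_zero_iff.2 fun q hq => (hS q hq).1.ne_zero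
    have hN1 : 1 < N := hp₀.one_lt.trans_le (Nat.le_mul_of_pos_right _ (Nat.pos_of_ne_zero hprod))
    have hpN : ¬p ∣ N := by
      rw [hN, hp.dvd_mul, not_or, Nat.prime_dvd_prime_iff_eq hp hp₀]
      refine ⟨hpp₀, fun h => ?_⟩
      obtain ⟨q, hq, hpq⟩ := (hp.prime.dvd_finsetProd_iff _).1 h
      exact hpS ((Nat.prime_dvd_prime_iff_eq hp (hS q hq).1).1 hpq ▸ hq)
    have hexp : p₀ * ∏ q ∈ insert p S, q = N * p := by
      rw [Finset.prod_insert hpS, hN]; ring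
    have hrec := unitaryCyclotomic_mul_prime_pow (by omega) hp hpN one_ne_zero
    rw [pow_one] at hrec
    have hNp : 1 < N * p := hN1.trans_le (Nat.le_mul_of_pos_right _ hp.pos)
    have hc : (unitaryCyclotomic (N * p)).coeff 1 = -(unitaryCyclotomic N).coeff 1 := by
      have h := congrArg (fun f => coeff f 1) hrec
      simp only [coeff_expand hp.pos, Nat.dvd_one, hp.ne_one, if_false] at h
      rw [mul_coeff_one, unitaryCyclotomic_coeff_zero hN1, unitaryCyclotomic_coeff_zero hNp] at h
      linarith
    have hss : X ^ B ∣ (∑ q ∈ S, X ^ q : ℤ[X]) * ∑ q ∈ S, X ^ q := by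
      rw [Finset.sum_mul_sum]
      refine Finset.dvd_sum fun i hi => Finset.dvd_sum fun j hj => ?_
      rw [← pow_add]
      exact pow_dvd_pow _ (by have := (hS i hi).2.2; have := (hS j hj).2.2; omega)
    have hsp : X ^ B ∣ (∑ q ∈ S, X ^ q : ℤ[X]) * X ^ p := by
      rw [Finset.sum_mul]
      refine Finset.dvd_sum fun i hi => ?_
      rw [← pow_add]
      exact pow_dvd_pow _ (by have := (hS i hi).2.2; omega)
    obtain ⟨w, hw⟩ := hss
    obtain ⟨w', hw'⟩ := hsp
    obtain ⟨u, hu⟩ := X_pow_dvd_expand_sub (unitaryCyclotomic_coeff_zero hN1) hp.pos hBp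
    rw [← hrec] at hu
    rw [hexp, Finset.card_insert_of_notMem hpS, Nat.even_add_one, Nat.odd_add_one,
      Nat.not_even_iff_odd, Nat.not_odd_iff_even, hc]
    rw [Finset.sum_insert hpS]
    generalize unitaryCyclotomic (N * p) = F at *
    generalize unitaryCyclotomic N = G at *
    generalize unitaryCyclotomic p₀ = A at *
    generalize (∑ q ∈ S, X ^ q : ℤ[X]) = s at *
    constructor
    · intro h
      obtain ⟨h1, v, hv⟩ := ih.2 h
      rw [h1] at hu
      simp only [map_neg, map_one] at hu
      refine ⟨by rw [h1, neg_neg], (1 - s) * (A * u - F * v) + F * w + A * w', ?_⟩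
      linear_combination (1 - s) * (A * hu - F * hv) + F * hw + A * hw'
    · intro h
      obtain ⟨h1, v, hv⟩ := ih.1 h
      rw [h1] at hu
      simp only [map_one] at hu
      refine ⟨by rw [h1], (1 + s) * (u - F * v) + F * A * w + w', ?_⟩
      linear_combination (1 + s) * (hu - F * hv) + F * A * hw + hw'

/-- There are intervals `(M, 2M]` with `M` arbitrarily large containing arbitrarily many primes. -/
theorem exists_card_primes_Ioc_two_mul_ge (k N : ℕ) :
    ∃ M, N ≤ M ∧ k ≤ ((Finset.Ioc M (2 * M)).filter Nat.Prime).card := by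
  by_contra! h
  have hcount (i : ℕ) : Nat.primeCounting (2 ^ i) ≤ 2 ^ N + k * i := by
    induction i with
    | zero => simp
    | succ i ih =>
      rcases lt_or_ge (2 ^ i) N with hi | hi
      · have h1 : Nat.primeCounting (2 ^ (i + 1)) ≤ 2 ^ (i + 1) := by
          rw [← Nat.primesLE_card_eq_primeCounting, Nat.primesLE_eq_filter_Ioc_zero]
          simpa using Finset.card_filter_le (Finset.Ioc 0 (2 ^ (i + 1))) Nat.Prime
        have h2 : i + 1 ≤ N := Nat.lt_two_pow_self.trans hi
        have h3 := Nat.pow_le_pow_right two_pos h2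
        omega
      · have h1 := h _ hi
        have h2 : Nat.primeCounting (2 ^ (i + 1)) ≤ Nat.primeCounting (2 ^ i) +
            ((Finset.Ioc (2 ^ i) (2 * 2 ^ i)).filter Nat.Prime).card := by
          rw [← Nat.primesLE_card_eq_primeCounting, ← Nat.primesLE_card_eq_primeCounting]
          refine (Finset.card_le_card fun p hp => ?_).trans (Finset.card_union_le _ _)
          rw [Nat.mem_primesLE] at hp
          rw [Finset.mem_union, Nat.mem_primesLE, Finset.mem_filter, Finset.mem_Ioc, ← pow_succ']
          have := le_or_gt p (2 ^ i)
          tauto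
        rw [mul_add]
        omega
  have hpow (i : ℕ) : 2 ^ i ≤ i + 1 + (2 ^ N + k * i) * i := by
    have h1 := Chebyshev.psi_ge (2 ^ i)
    have h2 := Chebyshev.psi_le_primeCounting_mul_log (2 ^ i)
    have h3 : Real.log (((2 ^ i : ℕ) : ℝ) + 1) ≤ (i + 1) * Real.log 2 := by
      rw [← Nat.cast_succ i, ← Real.log_pow]
      refine Real.log_le_log (by positivity) ?_
      have : (1 : ℝ) ≤ 2 ^ i := one_le_pow₀ one_le_two
      push_cast
      rw [pow_succ]
      linarith
    have h4 : (Nat.primeCounting (2 ^ i) : ℝ) ≤ 2 ^ N + k * i := by exact_mod_cast hcount i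
    have h5 : Real.log ((2 ^ i : ℕ) : ℝ) = i * Real.log 2 := by push_cast; rw [Real.log_pow]
    rw [h5] at h2
    have h6 : (0 : ℝ) < Real.log 2 := Real.log_pos one_lt_two
    have h7 := mul_le_mul_of_nonneg_right h4 (by positivity : 0 ≤ i * Real.log 2)
    have h8 : ((2 ^ i : ℕ) : ℝ) * Real.log 2 ≤ (i + 1 + (2 ^ N + k * i) * i) * Real.log 2 := by
      linarith
    exact_mod_cast le_of_mul_le_mul_right h8 h6
  generalize 2 ^ N = A at hpow
  have h1 := hpow (3 * (9 * k + 3 * A + 3))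
  have h2 : (9 * k + 3 * A + 3 + 1) ^ 3 ≤ 2 ^ (3 * (9 * k + 3 * A + 3)) := by
    rw [mul_comm 3 (_ + _), pow_mul]
    exact Nat.pow_le_pow_left Nat.lt_two_pow_self 3
  have h3 := h2.trans h1
  ring_nf at h3
  nlinarith [Nat.zero_le (A * k)]

theorem exists_finset_primes_mod_eq {q : ℕ} (hq : 0 < q) (k N : ℕ) :
    ∃ M c, N ≤ M ∧ ∃ P : Finset ℕ, P.card = k ∧
      ∀ p ∈ P, p.Prime ∧ M < p ∧ p ≤ 2 * M ∧ p % q = c := by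
  obtain ⟨M, hM, hk⟩ := exists_card_primes_Ioc_two_mul_ge (q * k) N
  obtain ⟨c, -, hc⟩ := Finset.exists_le_card_fiber_of_mul_le_card_of_maps_to
    (t := Finset.range q) (f := fun p => p % q) (n := k)
    (fun p _ => Finset.mem_range.2 (Nat.mod_lt p hq)) ⟨0, Finset.mem_range.2 hq⟩ (by simpa using hk)
  obtain ⟨P, hP, hcard⟩ := Finset.exists_subset_card_eq hc
  refine ⟨M, c, hM, P, hcard, fun p hp => ?_⟩
  have := hP hp
  simp only [Finset.mem_filter, Finset.mem_Ioc] at this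
  tauto

theorem exists_mem_card_filter_le_eq (P : Finset ℕ) {s : ℕ} (hs : 1 ≤ s) (hsP : s ≤ P.card) :
    ∃ p ∈ P, (P.filter (· ≤ p)).card = s := by
  induction P using Finset.induction_on_max with
  | empty => simp at hsP; omega
  | insert a P ha ih =>
    have haP : a ∉ P := fun h => (ha a h).false
    rw [Finset.card_insert_of_notMem haP] at hsP
    rcases hsP.lt_or_eq with h | h
    · obtain ⟨p, hp, hps⟩ := ih (by omega)
      refine ⟨p, Finset.mem_insert_of_mem hp, ?_⟩
      rwa [Finset.filter_insert, if_neg (ha p hp).not_ge]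
    · refine ⟨a, Finset.mem_insert_self _ _, ?_⟩
      rw [Finset.filter_true_of_mem, Finset.card_insert_of_notMem haP, h]
      exact Finset.forall_mem_insert _ _ _ |>.2 ⟨le_rfl, fun x hx => (ha x hx).le⟩

/-- The solution of `G * (X ^ q - 1) = (X - 1) * ∑ p ∈ R, X ^ p` modulo `X ^ B`. -/
theorem coeff_eq_card_sub_card {q B : ℕ} (hq : 0 < q) {G : ℤ[X]} {R : Finset ℕ}
    (h : X ^ B ∣ G * (X ^ q - 1) - (X - 1) * ∑ p ∈ R, X ^ p) {j : ℕ} (hj : j < B) :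
    G.coeff j = ((R.filter fun p => p ≤ j ∧ p ≡ j [MOD q]).card : ℤ) -
      (R.filter fun p => p + 1 ≤ j ∧ p + 1 ≡ j [MOD q]).card := by
  have hcoeff (j : ℕ) : (∑ p ∈ R, X ^ p : ℤ[X]).coeff j = if j ∈ R then 1 else 0 := by
    simp [coeff_X_pow]
  have hcoeff' (j : ℕ) : (X * ∑ p ∈ R, X ^ p : ℤ[X]).coeff j =
      if ∃ p ∈ R, p + 1 = j then 1 else 0 := by
    cases j with
    | zero => simp
    | succ j => rw [coeff_X_mul, hcoeff]; simp
  induction j using Nat.strong_induction_on with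
  | _ j ih =>
    have hj0 := X_pow_dvd_iff.1 h j hj
    rw [mul_sub, sub_mul, one_mul, mul_one, coeff_sub, coeff_sub, coeff_sub, hcoeff, hcoeff',
      coeff_mul_X_pow'] at hj0
    have split (e : ℕ) : ((R.filter fun p => p + e ≤ j ∧ p + e ≡ j [MOD q]).card : ℤ) =
        (if q ≤ j then ((R.filter fun p => p + e ≤ j - q ∧ p + e ≡ j - q [MOD q]).card : ℤ)
          else 0) + if ∃ p ∈ R, p + e = j then 1 else 0 := by
      have hone : ((R.filter fun p => p + e = j).card : ℤ) =
          if ∃ p ∈ R, p + e = j then 1 else 0 := by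
        split_ifs with hex
        · obtain ⟨p, hp, rfl⟩ := hex
          rw [Nat.cast_eq_one, Finset.card_eq_one]
          refine ⟨p, ?_⟩
          ext x
          simp only [Finset.mem_filter, Finset.mem_singleton, add_left_inj]
          exact ⟨fun hx => hx.2, fun hx => ⟨hx ▸ hp, hx⟩⟩
        · rw [Nat.cast_eq_zero, Finset.card_eq_zero, Finset.filter_eq_empty_iff]
          exact fun p hp hpe => hex ⟨p, hp, hpe⟩
      rw [← hone]
      split_ifs with hqj
      · rw [← Nat.cast_add, ← Finset.card_union_of_disjoint, ← Finset.filter_or]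
        · congr 2
          refine Finset.filter_congr fun p _ => ?_
          have hmod : j - q ≡ j [MOD q] := by
            simpa [Nat.sub_add_cancel hqj] using (Nat.add_modEq_right (a := j - q) (n := q)).symm
          constructor
          · rintro ⟨hle, hpj⟩
            refine or_iff_not_imp_right.2 fun hne => ⟨?_, hpj.trans hmod.symm⟩
            have := Nat.le_of_dvd (by omega) ((Nat.modEq_iff_dvd' hle).1 hpj)
            omega
          · rintro (⟨hle, hpj⟩ | rfl)
            · exact ⟨by omega, hpj.trans hmod⟩
            · exact ⟨le_rfl, rfl⟩
        · rw [Finset.disjoint_filter]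
          rintro p - ⟨hle, -⟩
          omega
      · rw [zero_add]
        congr 2
        refine Finset.filter_congr fun p _ => ⟨fun ⟨hle, hpj⟩ => ?_, ?_⟩
        · exact hpj.eq_of_lt_of_lt (by omega) (by omega)
        · rintro rfl
          exact ⟨le_rfl, rfl⟩
    have s0 := split 0
    have s1 := split 1
    simp only [add_zero, exists_eq_right] at s0
    rw [s0, s1]
    split_ifs at hj0 ⊢ with h1
    all_goals first
      | (rw [ih (j - q) (by omega) (by omega)] at hj0; linarith)
      | linarith

theorem exists_coprime_unitaryCyclotomic_coeff_eq (m : ℕ) (hm : m ≠ 0) {t : ℤ} (ht : t ≠ 0) :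
    ∃ n j, 1 < n ∧ (∀ p ∈ m.primeFactors, ¬p ∣ n) ∧ (unitaryCyclotomic n).coeff j = t := by
  obtain ⟨q, hmq, hq⟩ := Nat.exists_infinite_primes (m + 1)
  obtain ⟨M, c, hM, P, hcard, hP⟩ :=
    exists_finset_primes_mod_eq hq.pos (2 * (t.natAbs + 1) + 1) (q + m)
  have hmodEq {p p' : ℕ} (hp : p ∈ P) (hp' : p' ∈ P) : p ≡ p' [MOD q] :=
    (hP p hp).2.2.2.trans (hP p' hp').2.2.2.symm
  have hsucc (p : ℕ) : ¬p + 1 ≡ p [MOD q] := fun h => hq.not_dvd_one <| by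
    simpa using (Nat.modEq_iff_dvd' (Nat.le_succ p)).1 h.symm
  have hqP {p : ℕ} (hp : p ∈ P) : ¬0 ≡ p [MOD q] := fun h => by
    have := (Nat.prime_dvd_prime_iff_eq hq (hP p hp).1).1 ((Nat.modEq_zero_iff_dvd).1 h.symm)
    have := (hP p hp).2.1
    omega
  have h0P : 0 ∉ P := fun h => (hP 0 h).1.ne_zero rfl
  have hprod : ∏ p ∈ P, p ≠ 0 := Finset.prod_ne_zero_iff.2 fun p hp => (hP p hp).1.ne_zero
  obtain ⟨-, v, hv⟩ := (unitaryCyclotomic_prime_mul_prod (B := 2 * M + 1) hq P fun p hp =>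
    ⟨(hP p hp).1, by have := (hP p hp).2.1; omega, by have := (hP p hp).2.1; omega⟩).2
      (hcard ▸ odd_two_mul_add_one _)
  have hdvd : X ^ (2 * M + 1) ∣ unitaryCyclotomic (q * ∏ p ∈ P, p) * (X ^ q - 1) -
      (X - 1) * ∑ p ∈ insert 0 P, X ^ p := by
    refine ⟨(X - 1) * v, ?_⟩
    rw [← unitaryCyclotomic_prime_mul_X_sub_one hq, Finset.sum_insert h0P]
    linear_combination (X - 1) * hv
  refine ⟨q * ∏ p ∈ P, p, ?_⟩
  suffices ∃ j, (unitaryCyclotomic (q * ∏ p ∈ P, p)).coeff j = t by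
    obtain ⟨j, hj⟩ := this
    refine ⟨j, hq.one_lt.trans_le (Nat.le_mul_of_pos_right _ (Nat.pos_of_ne_zero hprod)), ?_, hj⟩
    intro r hr hrn
    have hrm := Nat.le_of_mem_primeFactors hr
    have hrp := Nat.prime_of_mem_primeFactors hr
    rcases hrp.dvd_mul.1 hrn with h | h
    · have := (Nat.prime_dvd_prime_iff_eq hrp hq).1 h
      omega
    · obtain ⟨p, hp, hrp'⟩ := (hrp.prime.dvd_finsetProd_iff _).1 h
      have := (Nat.prime_dvd_prime_iff_eq hrp (hP p hp).1).1 hrp'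
      have := (hP p hp).2.1
      omega
  rcases lt_or_gt_of_ne ht with ht | ht
  · have hδ : (if c + 1 ≡ 0 [MOD q] then 1 else 0) ≤ 1 := by split_ifs <;> omega
    obtain ⟨p, hp, hcount⟩ := exists_mem_card_filter_le_eq P
      (s := t.natAbs + if c + 1 ≡ 0 [MOD q] then 1 else 0) (by omega) (by omega)
    have hpM : p + 1 < 2 * M + 1 := by
      have h1 := (hP p hp).2
      rcases h1.2.1.lt_or_eq with h | h
      · omega
      · exact absurd (h ▸ (hP p hp).1) (Nat.not_prime_mul (by omega) (by omega))
    have hcp : c + 1 ≡ p + 1 [MOD q] := by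
      rw [← (hP p hp).2.2.2]
      exact (Nat.mod_modEq p q).add_right 1
    refine ⟨p + 1, ?_⟩
    rw [coeff_eq_card_sub_card hq.pos hdvd hpM, Finset.filter_insert, Finset.filter_insert]
    have e1 : P.filter (fun x => x ≤ p + 1 ∧ x ≡ p + 1 [MOD q]) = ∅ :=
      Finset.filter_eq_empty_iff.2 fun x hx h => hsucc p (h.2.symm.trans (hmodEq hx hp))
    have e2 : P.filter (fun x => x + 1 ≤ p + 1 ∧ x + 1 ≡ p + 1 [MOD q]) = P.filter (· ≤ p) :=
      Finset.filter_congr fun x hx =>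
        ⟨fun h => Nat.le_of_succ_le_succ h.1, fun h => ⟨Nat.succ_le_succ h, (hmodEq hx hp).add_right 1⟩⟩
    have e3 : ¬(0 + 1 ≤ p + 1 ∧ 0 + 1 ≡ p + 1 [MOD q]) :=
      fun h => hqP hp (Nat.ModEq.add_right_cancel' 1 h.2)
    have e4 : (0 ≤ p + 1 ∧ 0 ≡ p + 1 [MOD q]) ↔ c + 1 ≡ 0 [MOD q] :=
      ⟨fun h => hcp.trans h.2.symm, fun h => ⟨by omega, h.symm.trans hcp⟩⟩
    rw [if_neg e3, e1, e2, hcount]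
    simp only [e4]
    split_ifs <;> simp only [insert_empty_eq, Finset.card_singleton, Finset.card_empty] <;> omega
  · have hδ : (if c ≡ 1 [MOD q] then 1 else 0) ≤ 1 := by split_ifs <;> omega
    obtain ⟨p, hp, hcount⟩ := exists_mem_card_filter_le_eq P
      (s := t.natAbs + if c ≡ 1 [MOD q] then 1 else 0) (by omega) (by omega)
    have hcp : c ≡ p [MOD q] := by
      rw [← (hP p hp).2.2.2]
      exact Nat.mod_modEq p q
    refine ⟨p, ?_⟩
    rw [coeff_eq_card_sub_card hq.pos hdvd (Nat.lt_succ_of_le (hP p hp).2.2.1),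
      Finset.filter_insert, Finset.filter_insert]
    have e1 : P.filter (fun x => x + 1 ≤ p ∧ x + 1 ≡ p [MOD q]) = ∅ :=
      Finset.filter_eq_empty_iff.2 fun x hx h => hsucc x (h.2.trans (hmodEq hp hx))
    have e2 : P.filter (fun x => x ≤ p ∧ x ≡ p [MOD q]) = P.filter (· ≤ p) :=
      Finset.filter_congr fun x hx => ⟨fun h => h.1, fun h => ⟨h, hmodEq hx hp⟩⟩
    have e3 : ¬(0 ≤ p ∧ 0 ≡ p [MOD q]) := fun h => hqP hp h.2
    have e4 : (0 + 1 ≤ p ∧ 0 + 1 ≡ p [MOD q]) ↔ c ≡ 1 [MOD q] :=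
      ⟨fun h => hcp.trans h.2.symm, fun h => ⟨(hP p hp).1.pos, h.symm.trans hcp⟩⟩
    rw [if_neg e3, e1, e2, hcount]
    simp only [e4]
    split_ifs <;> simp only [insert_empty_eq, Finset.card_singleton, Finset.card_empty] <;> omega

/-- For fixed `m ≥ 1`, every integer occurs as a coefficient of `Φ*_{mn}` for some `n ≥ 1`. -/
theorem every_int_is_unitaryCyclotomic_coeff (m : ℕ) (hm : 1 ≤ m) (t : ℤ) :
    ∃ n : ℕ, 1 ≤ n ∧ ∃ j : ℕ, (unitaryCyclotomic (m * n)).coeff j = t := by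
  rcases eq_or_ne t 0 with rfl | ht
  · exact ⟨1, le_rfl, _, coeff_natDegree_succ_eq_zero⟩
  have hm0 : m ≠ 0 := by omega
  obtain ⟨n, j, hn, hmn, hj⟩ := exists_coprime_unitaryCyclotomic_coeff_eq m hm0 ht
  obtain ⟨S, hmS, hS, hSeven⟩ : ∃ S : Finset ℕ, m.primeFactors ⊆ S ∧
      (∀ p ∈ S, p.Prime ∧ ¬p ∣ n) ∧ Even S.card := by
    have hprime : ∀ p ∈ m.primeFactors, p.Prime ∧ ¬p ∣ n :=
      fun p hp => ⟨Nat.prime_of_mem_primeFactors hp, hmn p hp⟩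
    rcases Nat.even_or_odd m.primeFactors.card with h | h
    · exact ⟨_, subset_rfl, hprime, h⟩
    · obtain ⟨r, hr, hrp⟩ := Nat.exists_infinite_primes (m + n + 1)
      refine ⟨insert r m.primeFactors, Finset.subset_insert _ _, ?_, ?_⟩
      · refine (Finset.forall_mem_insert _ _ _).2 ⟨⟨hrp, fun h => ?_⟩, hprime⟩
        have := Nat.le_of_dvd (by omega) h
        omega
      · rw [Finset.card_insert_of_notMem]
        · exact h.add_one
        · intro h
          have := Nat.le_of_mem_primeFactors h
          omega
  have hdvd : m ∣ n * ∏ p ∈ S, p ^ (m + j) := by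
    refine Dvd.dvd.mul_left ?_ n
    calc m = ∏ p ∈ m.primeFactors, p ^ m.factorization p :=
          (Nat.prod_factorization_pow_eq_self hm0).symm
      _ ∣ ∏ p ∈ m.primeFactors, p ^ (m + j) := Finset.prod_dvd_prod_of_dvd _ _ fun p _ =>
          pow_dvd_pow p ((Nat.factorization_lt p hm0).le.trans (Nat.le_add_right m j))
      _ ∣ _ := Finset.prod_dvd_prod_of_subset _ _ _ hmS
  have hcongr := (unitaryCyclotomic_mul_prod_prime_pow (B := j + 1) (a := m + j) hn (by omega)
    ((by omega : j + 1 ≤ m + j).trans Nat.lt_two_pow_self.le) S hS).1 hSeven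
  have hcoeff := X_pow_dvd_iff.1 hcongr j j.lt_succ_self
  obtain ⟨l, hl⟩ := hdvd
  refine ⟨l, Nat.pos_of_ne_zero ?_, j, ?_⟩
  · rintro rfl
    rw [mul_zero, mul_eq_zero, Finset.prod_eq_zero_iff] at hl
    rcases hl with h | ⟨p, hp, h⟩
    · omega
    · exact pow_ne_zero _ (hS p hp).1.ne_zero h
  · rw [← hl, ← hj]
    rwa [coeff_sub, sub_eq_zero] at hcoeff
end

section
/- Let m ≥ 1 be a fixed positive integer. For every integer t there exist a positive integer n and a natural number j such that the coefficient of X^j in Ψ*_{mn} equals t. In other words, {c*_{mn}(j) : n ≥ 1, j ≥ 0} = ℤ, where c*_k(j) denotes the coefficient of X^j in Ψ*_k. -/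
open Polynomial

/-- The inverse unitary cyclotomic polynomial `Ψ*_n`, satisfying `Φ*_n · Ψ*_n = X^n − 1`. -/
noncomputable def unitaryCyclotomicInv (n : ℕ) : Polynomial ℤ :=
  (X ^ n - 1) /ₘ unitaryCyclotomic n

open Finset in
/-- For `k` arbitrary there is a dyadic interval containing `k` primes congruent to `1` mod `M`. -/
theorem exists_dyadic_card_primes_modEq_one (M k : ℕ) (hM : M ≠ 0) :
    ∃ P : ℕ, ∃ S : Finset ℕ, S.card = k ∧
      ∀ p ∈ S, p.Prime ∧ p ≡ 1 [MOD M] ∧ P ≤ p ∧ p < 2 * P := by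
  have : NeZero M := ⟨hM⟩
  by_contra hcon
  let T : ℕ → Finset ℕ := fun i =>
    (Ico (2 ^ i) (2 ^ (i + 1))).filter fun p => p.Prime ∧ p ≡ 1 [MOD M]
  have hT (i : ℕ) : (T i).card ≤ k := by
    by_contra! h
    obtain ⟨S, hS, hSk⟩ := exists_subset_card_eq h.le
    refine hcon ⟨2 ^ i, S, hSk, fun p hp => ?_⟩
    have := hS hp
    simp only [T, mem_filter, mem_Ico, pow_succ] at this
    exact ⟨this.2.1, this.2.2, this.1.1, by lia⟩
  apply ArithmeticFunction.vonMangoldt.not_summable_residueClass_prime_div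
    (isUnit_one : IsUnit (1 : ZMod M))
  set f : ℕ → ℝ := fun n =>
    (if n.Prime then ArithmeticFunction.vonMangoldt.residueClass (1 : ZMod M) n else 0) / n with hf
  have hf0 (n : ℕ) : 0 ≤ f n := by
    have := ArithmeticFunction.vonMangoldt.residueClass_nonneg (1 : ZMod M) n
    simp only [hf]
    split_ifs <;> positivity
  have hzero (n : ℕ) (hn : ¬ (n.Prime ∧ n ≡ 1 [MOD M])) : f n = 0 := by
    by_cases hp : n.Prime
    · have h1 : ¬ ((n : ZMod M) = 1) := fun h => hn ⟨hp, by
        rwa [← ZMod.natCast_eq_natCast_iff, Nat.cast_one]⟩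
      simp [hf, ArithmeticFunction.vonMangoldt.residueClass, h1]
    · simp [hf, hp]
  have hbound (m n : ℕ) (h1 : 2 ^ m ≤ n) (h2 : n < 2 ^ (m + 1)) :
      f n ≤ (m + 1) / 2 ^ m := by
    have hnpos : 0 < n := lt_of_lt_of_le (by positivity) h1
    have hlog : Real.log n ≤ m + 1 := by
      have h3 : Real.log n ≤ Real.log (2 ^ (m + 1)) :=
        Real.log_le_log (by exact_mod_cast hnpos) (by exact_mod_cast h2.le)
      rw [Real.log_pow] at h3
      have := Real.log_two_lt_d9
      push_cast at h3
      nlinarith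
    have hnum : (if n.Prime then ArithmeticFunction.vonMangoldt.residueClass (1 : ZMod M) n
        else 0) ≤ (m + 1 : ℝ) := by
      split_ifs
      · exact (ArithmeticFunction.vonMangoldt.residueClass_le _ n).trans
          (ArithmeticFunction.vonMangoldt_le_log.trans hlog)
      · positivity
    simp only [hf]
    have h1' : (2 : ℝ) ^ m ≤ n := by exact_mod_cast h1
    gcongr
  have hsum (m : ℕ) : ∑ n ∈ range (2 ^ m), f n ≤ k * (4 - (2 * m + 4) / 2 ^ m) := by
    induction m with
    | zero => simp [hf]
    | succ m ih =>
      rw [← sum_range_add_sum_Ico f (Nat.pow_le_pow_right two_pos m.le_succ)]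
      have h1 : ∑ n ∈ Ico (2 ^ m) (2 ^ (m + 1)), f n ≤ k * ((m + 1) / 2 ^ m) := by
        rw [← sum_filter_of_ne (p := fun p => p.Prime ∧ p ≡ 1 [MOD M])
          (fun x _ hx => by_contra fun h => hx (hzero x h))]
        refine (sum_le_card_nsmul (T m) f ((m + 1) / 2 ^ m) fun n hn => ?_).trans ?_
        · simp only [T, mem_filter, mem_Ico] at hn
          exact hbound m n hn.1.1 hn.1.2
        · rw [nsmul_eq_mul]
          have := hT m
          gcongr
      refine (add_le_add ih h1).trans (le_of_eq ?_)
      push_cast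
      field_simp
      ring
  refine summable_of_sum_range_le (c := k * 4) hf0 fun n => ?_
  calc ∑ i ∈ range n, f i ≤ ∑ i ∈ range (2 ^ n), f i :=
        sum_le_sum_of_subset_of_nonneg (range_mono Nat.lt_two_pow_self.le) fun i _ _ => hf0 i
    _ ≤ k * (4 - (2 * n + 4) / 2 ^ n) := hsum n
    _ ≤ k * 4 := by
      gcongr
      have : (0 : ℝ) ≤ (2 * n + 4) / 2 ^ n := by positivity
      linarith

theorem unitaryCyclotomic_monic (n : ℕ) : (unitaryCyclotomic n).Monic :=
  monic_prod_of_monic _ _ fun d _ => cyclotomic.monic d ℤ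

theorem unitaryCyclotomic_mul_inv {n : ℕ} (hn : 0 < n) :
    unitaryCyclotomic n * unitaryCyclotomicInv n = X ^ n - 1 := by
  have hdvd : unitaryCyclotomic n ∣ X ^ n - 1 := by
    rw [← prod_cyclotomic_eq_X_pow_sub_one hn ℤ]
    exact Finset.prod_dvd_prod_of_subset _ _ _ (Finset.filter_subset _ _)
  have h := modByMonic_add_div (X ^ n - 1 : ℤ[X]) (unitaryCyclotomic n)
  rwa [(modByMonic_eq_zero_iff_dvd (unitaryCyclotomic_monic n)).2 hdvd, zero_add] at h

theorem unitaryCyclotomic_mul_prime {n p : ℕ} (hn : n ≠ 0) (hp : p.Prime) (hpn : ¬ p ∣ n) :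
    unitaryCyclotomic (n * p) * unitaryCyclotomic n = expand ℤ p (unitaryCyclotomic n) := by
  have hset : (n * p).divisors.filter (fun d => d.primeFactors = (n * p).primeFactors) =
      (n.divisors.filter (fun d => d.primeFactors = n.primeFactors)).image (· * p) := by
    have hpf (e : ℕ) (he : e ≠ 0) : (e * p).primeFactors = insert p e.primeFactors := by
      rw [Nat.primeFactors_mul he hp.ne_zero, hp.primeFactors, Finset.union_comm,
        Finset.insert_eq]
    have hpn' : p ∉ n.primeFactors := fun h => hpn (Nat.dvd_of_mem_primeFactors h)
    ext d
    simp only [Finset.mem_filter, Nat.mem_divisors, Finset.mem_image]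
    constructor
    · rintro ⟨⟨hd, -⟩, hdp⟩
      have hpd : p ∣ d := by
        apply Nat.dvd_of_mem_primeFactors
        rw [hdp, hpf n hn]
        exact Finset.mem_insert_self _ _
      obtain ⟨e, rfl⟩ := hpd
      rw [mul_comm p e] at *
      have hen : e ∣ n := Nat.dvd_of_mul_dvd_mul_right hp.pos hd
      have he0 : e ≠ 0 := fun h => hn (by simpa [h] using hen)
      have hpe : p ∉ e.primeFactors := fun h => hpn ((Nat.dvd_of_mem_primeFactors h).trans hen)
      refine ⟨e, ⟨⟨hen, hn⟩, ?_⟩, rfl⟩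
      rw [hpf e he0, hpf n hn] at hdp
      rw [← Finset.erase_insert hpe, hdp, Finset.erase_insert hpn']
    · rintro ⟨e, ⟨⟨hen, -⟩, hep⟩, rfl⟩
      have he0 : e ≠ 0 := fun h => hn (by simpa [h] using hen)
      refine ⟨⟨Nat.mul_dvd_mul_right hen p, mul_ne_zero hn hp.ne_zero⟩, ?_⟩
      rw [hpf e he0, hpf n hn, hep]
  unfold unitaryCyclotomic
  rw [hset, Finset.prod_image fun a _ b _ h => Nat.eq_of_mul_eq_mul_right hp.pos h,
    ← Finset.prod_mul_distrib, map_prod]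
  refine Finset.prod_congr rfl fun d hd => ?_
  simp only [Finset.mem_filter, Nat.mem_divisors] at hd
  exact (cyclotomic_expand_eq_cyclotomic_mul hp (fun h => hpn (h.trans hd.1.1)) ℤ).symm

theorem coeff_zero_one_prod {ι : Type*} (s : Finset ι) (f : ι → ℤ[X])
    (hf : ∀ i ∈ s, (f i).coeff 0 = 1) :
    (∏ i ∈ s, f i).coeff 0 = 1 ∧ (∏ i ∈ s, f i).coeff 1 = ∑ i ∈ s, (f i).coeff 1 := by
  classical
  induction s using Finset.induction_on with
  | empty => simp [coeff_one]
  | insert a s ha ih =>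
    obtain ⟨h0, h1⟩ := ih fun i hi => hf i (Finset.mem_insert_of_mem hi)
    have ha' := hf a (Finset.mem_insert_self a s)
    rw [Finset.prod_insert ha, Finset.sum_insert ha]
    refine ⟨by rw [mul_coeff_zero, h0, ha', one_mul], ?_⟩
    rw [mul_coeff_one, h0, h1, ha']
    ring

theorem cyclotomic_coeff_one {n : ℕ} (hn : n ≠ 0) :
    (Squarefree n → IsUnit ((cyclotomic n ℤ).coeff 1)) ∧
      (¬ Squarefree n → (cyclotomic n ℤ).coeff 1 = 0) := by
  induction n using induction_on_primes with
  | zero => exact absurd rfl hn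
  | one => simp [coeff_one, coeff_X]
  | prime_mul p a hp ih =>
    have ha : a ≠ 0 := right_ne_zero_of_mul hn
    obtain ⟨ih1, ih2⟩ := ih ha
    have hexp : (expand ℤ p (cyclotomic a ℤ)).coeff 1 = 0 := by
      rw [coeff_expand hp.pos, if_neg hp.not_dvd_one]
    rw [mul_comm p a]
    by_cases hpa : p ∣ a
    · rw [cyclotomic_expand_eq_cyclotomic hp hpa] at hexp
      refine ⟨fun h => ?_, fun _ => hexp⟩
      obtain ⟨b, rfl⟩ := hpa
      exact absurd (h p ⟨b, by ring⟩) hp.prime.not_isUnit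
    · have hsq : Squarefree (a * p) ↔ Squarefree a := by
        rw [Nat.squarefree_mul ((hp.coprime_iff_not_dvd.2 hpa).symm)]
        exact and_iff_left hp.prime.squarefree
      have h0 : IsUnit ((cyclotomic a ℤ).coeff 0) := by
        rcases (Nat.one_le_iff_ne_zero.2 ha).eq_or_lt with rfl | h
        · simp
        · rw [cyclotomic_coeff_zero ℤ h]; exact isUnit_one
      have h0' : (cyclotomic (a * p) ℤ).coeff 0 = 1 :=
        cyclotomic_coeff_zero ℤ (lt_of_lt_of_le hp.one_lt
          (Nat.le_mul_of_pos_left p (Nat.pos_of_ne_zero ha)))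
      rw [cyclotomic_expand_eq_cyclotomic_mul hp hpa, mul_coeff_one, h0', one_mul] at hexp
      rw [hsq]
      refine ⟨fun h => ?_, fun h => ?_⟩
      · have h1 : IsUnit ((cyclotomic (a * p) ℤ).coeff 1 * (cyclotomic a ℤ).coeff 0) := by
          rw [show (cyclotomic (a * p) ℤ).coeff 1 * (cyclotomic a ℤ).coeff 0 =
            -(cyclotomic a ℤ).coeff 1 by linear_combination hexp]
          exact (ih1 h).neg
        exact isUnit_of_mul_isUnit_left h1
      · rw [ih2 h, zero_add] at hexp
        exact (mul_eq_zero.1 hexp).resolve_right h0.ne_zero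

theorem unitaryCyclotomic_coeff_zero_one {n : ℕ} (hn : 1 < n) :
    (unitaryCyclotomic n).coeff 0 = 1 ∧ IsUnit ((unitaryCyclotomic n).coeff 1) := by
  have hn0 : n ≠ 0 := by lia
  have hone : ∀ d ∈ n.divisors.filter (fun d => d.primeFactors = n.primeFactors),
      (cyclotomic d ℤ).coeff 0 = 1 := by
    intro d hd
    simp only [Finset.mem_filter, Nat.mem_divisors] at hd
    apply cyclotomic_coeff_zero
    rw [← Nat.nonempty_primeFactors, hd.2, Nat.nonempty_primeFactors]
    exact hn
  obtain ⟨h0, h1⟩ := coeff_zero_one_prod _ _ hone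
  refine ⟨h0, ?_⟩
  unfold unitaryCyclotomic
  have hsqf : Squarefree (∏ p ∈ n.primeFactors, p) := by
    rw [← Nat.radical_eq_prod_primeFactors]; exact UniqueFactorizationMonoid.squarefree_radical
  have hmem : ∏ p ∈ n.primeFactors, p ∈
      n.divisors.filter (fun d => d.primeFactors = n.primeFactors) := by
    simp only [Finset.mem_filter, Nat.mem_divisors]
    exact ⟨⟨Nat.prod_primeFactors_dvd n, hn0⟩, Nat.primeFactors_prod fun p hp =>
      Nat.prime_of_mem_primeFactors hp⟩
  rw [h1, Finset.sum_eq_single_of_mem _ hmem]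
  · exact (cyclotomic_coeff_one hsqf.ne_zero).1 hsqf
  · intro d hd hne
    simp only [Finset.mem_filter, Nat.mem_divisors] at hd
    refine (cyclotomic_coeff_one (fun h => hn0 (by simpa [h] using hd.1.1))).2 fun hsq => hne ?_
    rw [← Nat.prod_primeFactors_of_squarefree hsq, hd.2]

theorem unitaryCyclotomic_mul_prime_coeff_one {n p : ℕ} (hn : 1 < n) (hp : p.Prime)
    (hpn : ¬ p ∣ n) :
    (unitaryCyclotomic (n * p)).coeff 1 = -(unitaryCyclotomic n).coeff 1 := by
  have h := congrArg (fun f => f.coeff 1) (unitaryCyclotomic_mul_prime (by lia) hp hpn)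
  rw [mul_coeff_one, coeff_expand hp.pos, if_neg hp.not_dvd_one,
    (unitaryCyclotomic_coeff_zero_one hn).1,
    (unitaryCyclotomic_coeff_zero_one (hn.trans_le (Nat.le_mul_of_pos_right n hp.pos))).1] at h
  linear_combination h

section Truncation

variable {R : Type*} [CommRing R] (φ : ℤ[X] →+* R)

theorem map_expand_of_pow_eq_zero (f : ℤ[X]) (hf : f.coeff 0 = 1) {p D : ℕ} (hD : D ≤ 2 * p)
    (hφ : φ X ^ D = 0) : φ (expand ℤ p f) = 1 + (f.coeff 1 : R) * φ X ^ p := by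
  have h1 := divX_mul_X_add f
  have h2 := divX_mul_X_add f.divX
  rw [coeff_divX, zero_add] at h2
  rw [hf, ← h2] at h1
  have hz : φ X ^ p * φ X ^ p = 0 := by
    rw [← pow_add]; exact pow_eq_zero_of_le (by lia) hφ
  have hC (a : ℤ) : φ (C a) = a := by simp
  rw [← h1]
  simp only [map_add, map_mul, expand_X, expand_C, map_pow, hC, Int.cast_one]
  simp only [coeff_add, coeff_mul_X, coeff_C_succ, coeff_C_zero, mul_coeff_zero, coeff_X_zero]
  push_cast
  simp only [mul_zero, zero_add, add_zero]
  linear_combination (φ (expand ℤ p f.divX.divX)) * hz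

theorem map_unitaryCyclotomic_mul_prod_primes {M P : ℕ} (hM : 1 < M) (hφ : φ X ^ (2 * P) = 0)
    (S : Finset ℕ) (hS : ∀ p ∈ S, p.Prime ∧ ¬ p ∣ M ∧ P ≤ p) :
    (unitaryCyclotomic (M * ∏ p ∈ S, p)).coeff 1 =
        (-1) ^ S.card * (unitaryCyclotomic M).coeff 1 ∧
      (Even S.card → φ (unitaryCyclotomic (M * ∏ p ∈ S, p)) = φ (unitaryCyclotomic M) *
        (1 - ((unitaryCyclotomic M).coeff 1 : R) * ∑ p ∈ S, φ X ^ p)) ∧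
      (Odd S.card → φ (unitaryCyclotomic (M * ∏ p ∈ S, p)) * φ (unitaryCyclotomic M) =
        1 + ((unitaryCyclotomic M).coeff 1 : R) * ∑ p ∈ S, φ X ^ p) := by
  induction S using Finset.induction_on with
  | empty => simp
  | insert p S hpS ih =>
    obtain ⟨hc, hev, hodd⟩ := ih fun q hq => hS q (Finset.mem_insert_of_mem hq)
    obtain ⟨hp, hpM, hPp⟩ := hS p (Finset.mem_insert_self p S)
    have hS' : ∀ q ∈ S, q.Prime ∧ P ≤ q := fun q hq =>
      ⟨(hS q (Finset.mem_insert_of_mem hq)).1, (hS q (Finset.mem_insert_of_mem hq)).2.2⟩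
    have hzero {a b : ℕ} (ha : P ≤ a) (hb : P ≤ b) : φ X ^ a * φ X ^ b = 0 := by
      rw [← pow_add]; exact pow_eq_zero_of_le (by lia) hφ
    have hxy : φ X ^ p * ∑ q ∈ S, φ X ^ q = 0 := by
      rw [Finset.mul_sum]
      exact Finset.sum_eq_zero fun q hq => hzero hPp (hS' q hq).2
    have hyy : (∑ q ∈ S, φ X ^ q) * ∑ q ∈ S, φ X ^ q = 0 := by
      rw [Finset.sum_mul_sum]
      exact Finset.sum_eq_zero fun q hq => Finset.sum_eq_zero fun r hr =>
        hzero (hS' q hq).2 (hS' r hr).2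
    rw [Finset.prod_insert hpS, Finset.sum_insert hpS, Finset.card_insert_of_notMem hpS,
      mul_comm p, ← mul_assoc]
    set N := M * ∏ q ∈ S, q with hN
    have hpN : ¬ p ∣ N := by
      rw [hN, hp.dvd_mul, hp.prime.dvd_finsetProd_iff]
      rintro (h | ⟨q, hq, h⟩)
      · exact hpM h
      · exact hpS (((Nat.prime_dvd_prime_iff_eq hp (hS' q hq).1).1 h) ▸ hq)
    have hN1 : 1 < N := hM.trans_le (Nat.le_mul_of_pos_right M
      (Finset.prod_pos fun q hq => (hS' q hq).1.pos))
    have hstep := congrArg φ (unitaryCyclotomic_mul_prime (by lia) hp hpN)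
    rw [map_mul, map_expand_of_pow_eq_zero φ _ (unitaryCyclotomic_coeff_zero_one hN1).1
      (show 2 * P ≤ 2 * p by lia) hφ, hc] at hstep
    refine ⟨?_, fun h => ?_, fun h => ?_⟩
    · rw [unitaryCyclotomic_mul_prime_coeff_one hN1 hp hpN, hc, pow_succ]
      ring
    · have hodd' : Odd S.card := by
        rwa [Nat.even_add_one, Nat.not_even_iff_odd] at h
      have h1 := hodd hodd'
      rw [hodd'.neg_one_pow] at hstep
      push_cast at hstep
      set c : R := ((unitaryCyclotomic M).coeff 1 : R)
      set y := ∑ q ∈ S, φ X ^ q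
      linear_combination (1 - c * y) * φ (unitaryCyclotomic M) * hstep
        - (1 - c * y) * φ (unitaryCyclotomic (N * p)) * h1
        + c ^ 2 * φ (unitaryCyclotomic (N * p)) * hyy + c ^ 2 * φ (unitaryCyclotomic M) * hxy
    · have hev' : Even S.card := by
        rwa [Nat.odd_add_one, Nat.not_odd_iff_even] at h
      have h1 := hev hev'
      rw [hev'.neg_one_pow] at hstep
      push_cast at hstep
      set c : R := ((unitaryCyclotomic M).coeff 1 : R)
      set y := ∑ q ∈ S, φ X ^ q
      linear_combination (1 + c * y) * hstep - (1 + c * y) * φ (unitaryCyclotomic (N * p)) * h1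
        + c ^ 2 * φ (unitaryCyclotomic (N * p)) * φ (unitaryCyclotomic M) * hyy + c ^ 2 * hxy

theorem exists_multiple_map_unitaryCyclotomic {M P : ℕ} (hM : 1 < M) (hφ : φ X ^ (2 * P) = 0)
    (S : Finset ℕ) (hS : ∀ p ∈ S, p.Prime ∧ ¬ p ∣ M ∧ P ≤ p) (hne : S.Nonempty) :
    ∃ n : ℕ, 2 * P ≤ M * n ∧ 1 ≤ n ∧ φ (unitaryCyclotomic (M * n)) = φ (unitaryCyclotomic M) *
        (1 - ((unitaryCyclotomic M).coeff 1 : R) * ∑ p ∈ S, φ X ^ p) := by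
  obtain ⟨-, hev, hodd⟩ := map_unitaryCyclotomic_mul_prod_primes φ hM hφ S hS
  have hprod : 0 < ∏ p ∈ S, p := Finset.prod_pos fun q hq => (hS q hq).1.pos
  have hle : 2 * P ≤ M * ∏ p ∈ S, p := by
    obtain ⟨p, hp⟩ := hne
    exact Nat.mul_le_mul hM ((hS p hp).2.2.trans
      (Nat.le_of_dvd hprod (Finset.dvd_prod_of_mem _ hp)))
  rcases Nat.even_or_odd S.card with h | h
  · exact ⟨∏ p ∈ S, p, hle, hprod, hev h⟩
  · have h1 := hodd h
    set N := M * ∏ p ∈ S, p with hN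
    have hN1 : 1 < N := hM.trans_le (Nat.le_mul_of_pos_right M hprod)
    obtain ⟨Q, hQ, hQp⟩ := Nat.exists_infinite_primes (N + 1)
    refine ⟨(∏ p ∈ S, p) * Q, ?_, Nat.mul_pos hprod hQp.pos, ?_⟩
    · rw [← mul_assoc, ← hN]
      exact hle.trans (Nat.le_mul_of_pos_right N hQp.pos)
    rw [← mul_assoc, ← hN]
    have hQN : ¬ Q ∣ N := fun h => by
      have := Nat.le_of_dvd (by lia) h
      lia
    have hstep := congrArg φ (unitaryCyclotomic_mul_prime (by lia) hQp hQN)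
    rw [map_mul, map_expand_of_pow_eq_zero φ _ (unitaryCyclotomic_coeff_zero_one hN1).1
      (show 2 * P ≤ 2 * Q by lia) hφ, pow_eq_zero_of_le (show 2 * P ≤ Q by lia) hφ, mul_zero,
      add_zero] at hstep
    have hyy : (∑ q ∈ S, φ X ^ q) * ∑ q ∈ S, φ X ^ q = 0 := by
      rw [Finset.sum_mul_sum]
      refine Finset.sum_eq_zero fun q hq => Finset.sum_eq_zero fun r hr => ?_
      have := (hS q hq).2.2
      have := (hS r hr).2.2
      rw [← pow_add]
      exact pow_eq_zero_of_le (by lia) hφ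
    set c : R := ((unitaryCyclotomic M).coeff 1 : R)
    set y := ∑ q ∈ S, φ X ^ q
    linear_combination (1 - c * y) * φ (unitaryCyclotomic M) * hstep
        - (1 - c * y) * φ (unitaryCyclotomic (N * Q)) * h1
        + c ^ 2 * φ (unitaryCyclotomic (N * Q)) * hyy

end Truncation

/-- The power series `-1 / Φ*_M` has `M`-periodic coefficients. -/
theorem exists_powerSeries_mul_unitaryCyclotomic {M : ℕ} (hM : 1 < M) :
    ∃ A : PowerSeries ℤ, A * (unitaryCyclotomic M : PowerSeries ℤ) = -1 ∧
      (∀ j, j ≡ 0 [MOD M] → PowerSeries.coeff j A = -1) ∧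
      (∀ j, j ≡ 1 [MOD M] → PowerSeries.coeff j A = (unitaryCyclotomic M).coeff 1) := by
  obtain ⟨hF0, hF1⟩ := unitaryCyclotomic_coeff_zero_one hM
  have hmul := unitaryCyclotomic_mul_inv (show 0 < M by lia)
  set F := unitaryCyclotomic M
  set G := unitaryCyclotomicInv M
  have hG0 : G.coeff 0 = -1 := by
    have h := congrArg (fun f => f.coeff 0) hmul
    simp only [mul_coeff_zero, hF0, coeff_sub, coeff_X_pow, coeff_one] at h
    simpa [show 0 ≠ M by lia] using h
  have hG1 : G.coeff 1 = F.coeff 1 := by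
    have h := congrArg (fun f => f.coeff 1) hmul
    simp only [mul_coeff_one, hF0, hG0, coeff_sub, coeff_X_pow, coeff_one] at h
    simp only [show 1 ≠ M by lia, if_false, one_ne_zero, sub_zero] at h
    linear_combination h
  have hG (j : ℕ) (hj : M ≤ j) : G.coeff j = 0 := by
    apply coeff_eq_zero_of_natDegree_lt
    have hGne : G ≠ 0 := fun h => by simp [h] at hG0
    have hFne : F ≠ 0 := fun h => by simp [h] at hF0
    have h1 := congrArg natDegree hmul
    rw [natDegree_mul hFne hGne, ← C_1, natDegree_X_pow_sub_C] at h1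
    have h2 : 1 ≤ F.natDegree := le_natDegree_of_ne_zero hF1.ne_zero
    lia
  set A : PowerSeries ℤ := PowerSeries.mk fun j => G.coeff (j % M) with hA
  have hAG : A * (1 - PowerSeries.X ^ M) = (G : PowerSeries ℤ) := by
    ext j
    rw [mul_sub, mul_one, map_sub, PowerSeries.coeff_mul_X_pow', hA, PowerSeries.coeff_mk,
      PowerSeries.coeff_mk, Polynomial.coeff_coe]
    split_ifs with h
    · rw [hG j h, ← Nat.mod_eq_sub_mod h, sub_self]
    · rw [Nat.mod_eq_of_lt (by lia), sub_zero]
  refine ⟨A, ?_, fun j hj => ?_, fun j hj => ?_⟩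
  · have h0 : (1 - PowerSeries.X ^ M : PowerSeries ℤ) ≠ 0 := fun h => by
      have := congrArg (PowerSeries.coeff 0) h
      simp [show M ≠ 0 by lia] at this
    apply mul_right_cancel₀ h0
    have hmul' := congrArg (Polynomial.coeToPowerSeries.ringHom (R := ℤ)) hmul
    simp only [map_mul, map_sub, map_pow, map_one, Polynomial.coeToPowerSeries.ringHom_apply,
      Polynomial.coe_X] at hmul'
    linear_combination (F : PowerSeries ℤ) * hAG + hmul'
  · rw [hA, PowerSeries.coeff_mk, show j % M = 0 from Eq.trans hj (Nat.zero_mod M), hG0]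
  · rw [hA, PowerSeries.coeff_mk, show j % M = 1 from Eq.trans hj (Nat.mod_eq_of_lt hM), hG1]

/-- Every value `(1 - l) * c`, with `c` the linear coefficient of `Φ*_M` and `l ≥ 1`, is a
coefficient of some `Ψ*_{Mn}`. -/
theorem exists_unitaryCyclotomicInv_coeff_eq {M : ℕ} (hM : 1 < M) {l : ℕ} (hl : 1 ≤ l) :
    ∃ n : ℕ, 1 ≤ n ∧ ∃ j : ℕ, (unitaryCyclotomicInv (M * n)).coeff j =
      (1 - l) * (unitaryCyclotomic M).coeff 1 := by
  obtain ⟨P, S, hcard, hS⟩ := exists_dyadic_card_primes_modEq_one M l (by lia)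
  have hne : S.Nonempty := by
    rw [← Finset.card_pos]; lia
  have hcop : ∀ p ∈ S, p.Prime ∧ ¬ p ∣ M ∧ P ≤ p := by
    intro p hp
    obtain ⟨h1, h2, h3, -⟩ := hS p hp
    refine ⟨h1, fun hdvd => ?_, h3⟩
    exact h1.not_dvd_one ((h2.dvd_iff hdvd).1 dvd_rfl)
  let I : Ideal (PowerSeries ℤ) := Ideal.span {PowerSeries.X ^ (2 * P)}
  let φ : ℤ[X] →+* PowerSeries ℤ ⧸ I :=
    (Ideal.Quotient.mk I).comp Polynomial.coeToPowerSeries.ringHom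
  have hφ (f : ℤ[X]) : φ f = Ideal.Quotient.mk I (f : PowerSeries ℤ) := rfl
  have hX : φ X = Ideal.Quotient.mk I PowerSeries.X := by rw [hφ, Polynomial.coe_X]
  have hX0 : φ X ^ (2 * P) = 0 := by
    rw [hX, ← map_pow, Ideal.Quotient.eq_zero_iff_mem]
    exact Ideal.mem_span_singleton_self _
  obtain ⟨n, hPn, hn, hmap⟩ := exists_multiple_map_unitaryCyclotomic φ hM hX0 S hcop hne
  obtain ⟨A, hAF, hA0, hA1⟩ := exists_powerSeries_mul_unitaryCyclotomic hM
  set c := (unitaryCyclotomic M).coeff 1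
  have hyy : (∑ q ∈ S, φ X ^ q) * ∑ q ∈ S, φ X ^ q = 0 := by
    rw [Finset.sum_mul_sum]
    refine Finset.sum_eq_zero fun q hq => Finset.sum_eq_zero fun r hr => ?_
    have := (hcop q hq).2.2
    have := (hcop r hr).2.2
    rw [← pow_add]
    exact pow_eq_zero_of_le (by lia) hX0
  have hinv := congrArg φ (unitaryCyclotomic_mul_inv (show 0 < M * n by positivity))
  rw [map_mul, map_sub, map_pow, map_one, pow_eq_zero_of_le hPn hX0, hmap] at hinv
  have hAF' := congrArg (Ideal.Quotient.mk I) hAF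
  rw [map_mul, map_neg, map_one, ← hφ] at hAF'
  have key : φ (unitaryCyclotomicInv (M * n)) =
      Ideal.Quotient.mk I A * (1 + (c : PowerSeries ℤ ⧸ I) * ∑ q ∈ S, φ X ^ q) := by
    set y := ∑ q ∈ S, φ X ^ q
    set G := φ (unitaryCyclotomicInv (M * n))
    generalize (c : PowerSeries ℤ ⧸ I) = d at hinv ⊢
    linear_combination (-(Ideal.Quotient.mk I A) * (1 + d * y)) * hinv + G * hAF'
      - d ^ 2 * Ideal.Quotient.mk I A * φ (unitaryCyclotomic M) * G * hyy
  have hlift : Ideal.Quotient.mk I A * (1 + (c : PowerSeries ℤ ⧸ I) * ∑ q ∈ S, φ X ^ q) =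
      Ideal.Quotient.mk I (A + c • ∑ q ∈ S, A * PowerSeries.X ^ q) := by
    rw [hX, ← Finset.mul_sum, zsmul_eq_mul]
    simp only [map_add, map_mul, map_sum, map_pow, map_intCast]
    ring
  rw [hlift, hφ, Ideal.Quotient.eq, Ideal.mem_span_singleton, PowerSeries.X_pow_dvd_iff] at key
  obtain ⟨-, hj1, -, hj2⟩ := hS _ (S.max'_mem hne)
  refine ⟨n, hn, S.max' hne, ?_⟩
  have hcoeff := key _ hj2
  rw [map_sub, Polynomial.coeff_coe, sub_eq_zero] at hcoeff
  rw [hcoeff, map_add, map_zsmul, map_sum, hA1 _ hj1, Finset.sum_congr rfl (g := fun _ => -1)]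
  · rw [Finset.sum_const, hcard]
    simp only [smul_eq_mul, nsmul_eq_mul]
    ring
  · intro q hq
    rw [PowerSeries.coeff_mul_X_pow', if_pos (S.le_max' q hq)]
    apply hA0
    have h := (hS q hq).2.1
    exact ((Nat.modEq_iff_dvd' (S.le_max' q hq)).1 (h.trans hj1.symm)).modEq_zero_nat

/-- For fixed `m ≥ 1`, every integer occurs as a coefficient of `Ψ*_{mn}` for some `n ≥ 1`. -/
theorem every_int_is_unitaryCyclotomicInv_coeff (m : ℕ) (hm : 1 ≤ m) (t : ℤ) :
    ∃ n : ℕ, 1 ≤ n ∧ ∃ j : ℕ, (unitaryCyclotomicInv (m * n)).coeff j = t := by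
  have key (M : ℕ) (hM : 1 < M) (hmM : m ∣ M) (l : ℕ) (hl : 1 ≤ l) :
      ∃ n : ℕ, 1 ≤ n ∧ ∃ j : ℕ, (unitaryCyclotomicInv (m * n)).coeff j =
        (1 - l) * (unitaryCyclotomic M).coeff 1 := by
    obtain ⟨k, rfl⟩ := hmM
    obtain ⟨n, hn, j, hj⟩ := exists_unitaryCyclotomicInv_coeff_eq hM hl
    have hk : 0 < k := Nat.pos_of_ne_zero fun h => by simp [h] at hM
    exact ⟨k * n, Nat.mul_pos hk hn, j, by rw [← mul_assoc, hj]⟩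
  have hM : 1 < m * 2 := by lia
  obtain ⟨q, hq, hqp⟩ := Nat.exists_infinite_primes (m * 2 + 1)
  have hqM : ¬ q ∣ m * 2 := fun h => by
    have := Nat.le_of_dvd (by lia) h
    lia
  have h1 := key (m * 2) hM (dvd_mul_right m 2) (t.natAbs + 1) (by lia)
  have h2 := key (m * 2 * q) (hM.trans_le (Nat.le_mul_of_pos_right _ hqp.pos))
    ((dvd_mul_right m 2).mul_right q) (t.natAbs + 1) (by lia)
  rw [unitaryCyclotomic_mul_prime_coeff_one hM hqp hqM] at h2
  rcases Int.isUnit_iff.1 (unitaryCyclotomic_coeff_zero_one hM).2 with hc | hc <;>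
    rw [hc] at h1 h2 <;> push_cast at h1 h2 <;>
    rcases abs_choice t with ht | ht <;> rw [ht] at h1 h2 <;> ring_nf at h1 h2 <;> assumption
end

section
/- Let p and q be coprime prime powers, each > 1. Then Φ*_{pq}(X) · (X^p − 1) · (X^q − 1) = (X^{pq} − 1)(X − 1) in ℤ[X]; equivalently, Φ*_{pq} equals the semigroup polynomial of the numerical semigroup S(p,q). -/
open Polynomial

theorem IsPrimePow.primeFactors_eq_of_dvd {n d : ℕ} (hn : IsPrimePow n) (hd : d ∣ n)
    (hd1 : d ≠ 1) : d.primeFactors = n.primeFactors := by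
  obtain ⟨r, k, hr, hk, rfl⟩ := (isPrimePow_nat_iff n).1 hn
  obtain ⟨i, -, rfl⟩ := (Nat.dvd_prime_pow hr).1 hd
  have hi : i ≠ 0 := by
    rintro rfl
    exact hd1 (pow_zero r)
  rw [Nat.primeFactors_prime_pow hi hr, Nat.primeFactors_prime_pow hk.ne' hr]

theorem Nat.Coprime.primeFactors_ne_of_dvd_left {p q d : ℕ} (h : Nat.Coprime p q)
    (hp : p ≠ 0) (hq : 1 < q) (hd : d ∣ p) : d.primeFactors ≠ (p * q).primeFactors := by
  intro he
  obtain ⟨s, hs⟩ := Nat.nonempty_primeFactors.2 hq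
  have hsd : s ∈ d.primeFactors := by
    rw [he, h.primeFactors_mul]
    exact Finset.mem_union_right _ hs
  exact Finset.disjoint_left.1 h.disjoint_primeFactors (Nat.primeFactors_mono hd hp hsd) hs

theorem Nat.divisors_filter_primeFactors_ne_of_isPrimePow {p q : ℕ}
    (hp : IsPrimePow p) (hq : IsPrimePow q) (hpq : Nat.Coprime p q) :
    (p * q).divisors.filter (fun d => ¬ d.primeFactors = (p * q).primeFactors) =
      p.divisors ∪ q.divisors := by
  ext d
  simp only [Finset.mem_filter, Finset.mem_union, Nat.mem_divisors, ne_eq, hp.ne_zero, hq.ne_zero,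
    mul_eq_zero, or_self, not_false_eq_true, and_true]
  constructor
  · rintro ⟨hd, hne⟩
    obtain ⟨x, y, hx, hy, rfl⟩ := (Nat.dvd_mul).1 hd
    by_cases hx1 : x = 1
    · exact Or.inr (by simpa [hx1] using hy)
    by_cases hy1 : y = 1
    · exact Or.inl (by simpa [hy1] using hx)
    refine absurd ?_ hne
    rw [((hpq.coprime_dvd_left hx).coprime_dvd_right hy).primeFactors_mul, hpq.primeFactors_mul,
      hp.primeFactors_eq_of_dvd hx hx1, hq.primeFactors_eq_of_dvd hy hy1]
  · rintro (hd | hd)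
    · exact ⟨hd.mul_right q, hpq.primeFactors_ne_of_dvd_left hp.ne_zero hq.one_lt hd⟩
    · refine ⟨hd.mul_left p, ?_⟩
      rw [mul_comm p q]
      exact hpq.symm.primeFactors_ne_of_dvd_left hq.ne_zero hp.one_lt hd

theorem Nat.Coprime.divisors_inter {p q : ℕ} (h : Nat.Coprime p q) (hp : p ≠ 0) (hq : q ≠ 0) :
    p.divisors ∩ q.divisors = {1} := by
  ext d
  rw [Finset.mem_inter, Nat.mem_divisors, Nat.mem_divisors, Finset.mem_singleton]
  constructor
  · rintro ⟨⟨h₁, -⟩, h₂, -⟩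
    exact Nat.eq_one_of_dvd_coprimes h h₁ h₂
  · rintro rfl
    exact ⟨⟨one_dvd p, hp⟩, one_dvd q, hq⟩

/-- For coprime prime powers `p, q > 1`:
`Φ*_{pq}(X) · (X^p − 1) · (X^q − 1) = (X^{pq} − 1)(X − 1)`, i.e. `Φ*_{pq}` is the
semigroup polynomial of the numerical semigroup `S(p,q)`. -/
theorem unitaryCyclotomic_eq_semigroup_polynomial (p q : ℕ)
    (hp : IsPrimePow p) (hq : IsPrimePow q) (hpq : Nat.Coprime p q) :
    unitaryCyclotomic (p * q) * (X ^ p - 1) * (X ^ q - 1) =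
      (X ^ (p * q) - 1) * (X - 1) := by
  have hunion := Finset.prod_union_inter (s₁ := p.divisors) (s₂ := q.divisors)
    (f := fun d => cyclotomic d ℤ)
  rw [hpq.divisors_inter hp.ne_zero hq.ne_zero, Finset.prod_singleton, cyclotomic_one] at hunion
  rw [mul_assoc, ← prod_cyclotomic_eq_X_pow_sub_one hp.pos ℤ,
    ← prod_cyclotomic_eq_X_pow_sub_one hq.pos ℤ, ← hunion, ← mul_assoc,
    ← Nat.divisors_filter_primeFactors_ne_of_isPrimePow hp hq hpq, unitaryCyclotomic,
    Finset.prod_filter_mul_prod_filter_not,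
    prod_cyclotomic_eq_X_pow_sub_one (Nat.mul_pos hp.pos hq.pos) ℤ]
end

section
/- Let p and q be coprime prime powers, each > 1, and let S(p,q) = {up + vq : u, v ∈ ℕ}. For every k ≥ 1, the coefficient a*_{pq}(k) of X^k in Φ*_{pq} equals 1 if k ∈ S(p,q) and k − 1 ∉ S(p,q); equals −1 if k ∉ S(p,q) and k − 1 ∈ S(p,q); and equals 0 otherwise. -/
open Polynomial

theorem primeFactors_eq_primeFactors_primePow_mul_iff {p q d : ℕ} (hp : IsPrimePow p)
    (hq : IsPrimePow q) (hpq : p.Coprime q) (hd : d ∣ p * q) :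
    d.primeFactors = (p * q).primeFactors ↔ ¬ (d ∣ p ∨ d ∣ q) := by
  obtain ⟨r, a, hr, ha, rfl⟩ := (isPrimePow_nat_iff p).1 hp
  obtain ⟨s, b, hs, hb, rfl⟩ := (isPrimePow_nat_iff q).1 hq
  have hrs : r.Coprime s := (Nat.coprime_pow_left_iff ha _ _).1
    ((Nat.coprime_pow_right_iff hb _ _).1 hpq)
  have hne : r ≠ s := fun h => by
    subst h
    exact hr.one_lt.ne' ((Nat.coprime_self r).1 hrs)
  have hfull : (r ^ a * s ^ b).primeFactors = {r, s} := by
    rw [Nat.primeFactors_mul (pow_ne_zero _ hr.ne_zero) (pow_ne_zero _ hs.ne_zero),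
      Nat.primeFactors_prime_pow ha.ne' hr, Nat.primeFactors_prime_pow hb.ne' hs]
    rfl
  rw [hfull]
  constructor
  · rintro h (h1 | h1)
    · have h2 : s ∣ d := Nat.dvd_of_mem_primeFactors (h ▸ by simp)
      exact hne.symm ((Nat.prime_dvd_prime_iff_eq hs hr).1
        (hs.dvd_of_dvd_pow (h2.trans h1)))
    · have h2 : r ∣ d := Nat.dvd_of_mem_primeFactors (h ▸ by simp)
      exact hne ((Nat.prime_dvd_prime_iff_eq hr hs).1 (hr.dvd_of_dvd_pow (h2.trans h1)))
  · intro h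
    obtain ⟨x, y, hx, hy, rfl⟩ := exists_dvd_and_dvd_of_dvd_mul hd
    obtain ⟨i, hi, rfl⟩ := (Nat.dvd_prime_pow hr).1 hx
    obtain ⟨j, hj, rfl⟩ := (Nat.dvd_prime_pow hs).1 hy
    have hi0 : i ≠ 0 := by
      rintro rfl
      exact h (Or.inr (by simpa using hy))
    have hj0 : j ≠ 0 := by
      rintro rfl
      exact h (Or.inl (by simpa using hx))
    rw [Nat.primeFactors_mul (pow_ne_zero _ hr.ne_zero) (pow_ne_zero _ hs.ne_zero),
      Nat.primeFactors_prime_pow hi0 hr, Nat.primeFactors_prime_pow hj0 hs]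
    rfl

theorem unitaryCyclotomic_primePow_mul {p q : ℕ} (hp : IsPrimePow p) (hq : IsPrimePow q)
    (hpq : p.Coprime q) :
    unitaryCyclotomic (p * q) * ((X ^ p - 1) * (X ^ q - 1)) = (X ^ (p * q) - 1) * (X - 1) := by
  have hp0 := hp.pos
  have hq0 := hq.pos
  have hpq0 : 0 < p * q := Nat.mul_pos hp0 hq0
  have hinter : p.divisors ∩ q.divisors = {1} := by
    ext d
    simp only [Finset.mem_inter, Nat.mem_divisors, Finset.mem_singleton]
    constructor
    · rintro ⟨⟨h1, -⟩, h2, -⟩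
      exact Nat.eq_one_of_dvd_coprimes hpq h1 h2
    · rintro rfl
      exact ⟨⟨one_dvd _, hp0.ne'⟩, one_dvd _, hq0.ne'⟩
  have hfilter : (p * q).divisors.filter (fun d => ¬ d.primeFactors = (p * q).primeFactors) =
      p.divisors ∪ q.divisors := by
    ext d
    simp only [Finset.mem_filter, Nat.mem_divisors, Finset.mem_union]
    constructor
    · rintro ⟨⟨h1, -⟩, h2⟩
      rw [primeFactors_eq_primeFactors_primePow_mul_iff hp hq hpq h1, not_not] at h2
      exact h2.imp (fun h => ⟨h, hp0.ne'⟩) (fun h => ⟨h, hq0.ne'⟩)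
    · intro h
      have h' : d ∣ p ∨ d ∣ q := h.imp And.left And.left
      have h1 : d ∣ p * q := h'.elim (fun h => h.mul_right _) (fun h => h.mul_left _)
      refine ⟨⟨h1, hpq0.ne'⟩, ?_⟩
      rwa [primeFactors_eq_primeFactors_primePow_mul_iff hp hq hpq h1, not_not]
  rw [← prod_cyclotomic_eq_X_pow_sub_one hp0 ℤ, ← prod_cyclotomic_eq_X_pow_sub_one hq0 ℤ,
    ← prod_cyclotomic_eq_X_pow_sub_one hpq0 ℤ, ← Finset.prod_union_inter, hinter,
    Finset.prod_singleton, cyclotomic_one, ← hfilter, ← mul_assoc, unitaryCyclotomic,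
    Finset.prod_filter_mul_prod_filter_not]

theorem mem_semigroup_and_not_sub_mem_iff {p q : ℕ} (hq : 0 < q)
    (hpq : p.Coprime q) (k : ℕ) :
    ((∃ u v : ℕ, u * p + v * q = k) ∧ ¬ (p ≤ k ∧ ∃ u v : ℕ, u * p + v * q = k - p)) ↔
      ∃ v < p, v * q = k := by
  constructor
  · rintro ⟨⟨u, v, rfl⟩, h⟩
    have hu : u = 0 := by
      by_contra hu
      obtain ⟨u, rfl⟩ := Nat.exists_eq_succ_of_ne_zero hu
      refine h ⟨by nlinarith, u, v, ?_⟩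
      rw [Nat.succ_mul]
      omega
    subst hu
    refine ⟨v, ?_, by simp⟩
    by_contra! hv
    obtain ⟨w, rfl⟩ := Nat.exists_eq_add_of_le hv
    obtain ⟨t, rfl⟩ := Nat.exists_eq_succ_of_ne_zero hq.ne'
    refine h ⟨by nlinarith, t, w, ?_⟩
    rw [Nat.succ_eq_add_one]
    apply Nat.eq_sub_of_add_eq
    ring
  · rintro ⟨v, hv, rfl⟩
    refine ⟨⟨0, v, by simp⟩, ?_⟩
    rintro ⟨hle, u, w, h⟩
    have h1 : (u + 1) * p + w * q = v * q := by
      rw [Nat.succ_mul]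
      omega
    have hwv : w < v := by
      by_contra! hc
      nlinarith [Nat.mul_le_mul_right q hc, Nat.zero_le (u * p)]
    have h2 : p ∣ (v - w) * q := ⟨u + 1, by rw [Nat.sub_mul, mul_comm p]; omega⟩
    have := Nat.le_of_dvd (by omega) (hpq.dvd_of_dvd_mul_right h2)
    omega

open Classical in
/-- The Hilbert series of the numerical semigroup generated by `p` and `q`. -/
noncomputable def semigroupHilbertSeries (p q : ℕ) : PowerSeries ℤ :=
  PowerSeries.mk fun k => if ∃ u v : ℕ, u * p + v * q = k then 1 else 0

theorem semigroupHilbertSeries_mul_one_sub_X_pow {p q : ℕ} (hq : 0 < q) (hpq : p.Coprime q) :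
    semigroupHilbertSeries p q * (1 - PowerSeries.X ^ p) =
      ∑ v ∈ Finset.range p, (PowerSeries.X ^ q) ^ v := by
  classical
  ext k
  have hrhs : PowerSeries.coeff k
      (∑ v ∈ Finset.range p, ((PowerSeries.X : PowerSeries ℤ) ^ q) ^ v) =
      if ∃ v < p, v * q = k then 1 else 0 := by
    simp only [map_sum, ← pow_mul, PowerSeries.coeff_X_pow]
    split_ifs with h
    · obtain ⟨v, hv, rfl⟩ := h
      rw [Finset.sum_eq_single_of_mem v (Finset.mem_range.2 hv)]
      · simp [mul_comm]
      · intro w _ hw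
        rw [if_neg]
        intro h
        exact hw (Nat.eq_of_mul_eq_mul_left hq (by rw [← h, mul_comm]))
    · refine Finset.sum_eq_zero fun v hv => if_neg fun hk => h ⟨v, Finset.mem_range.1 hv, ?_⟩
      rw [hk, mul_comm]
  rw [hrhs, mul_sub, mul_one, map_sub, PowerSeries.coeff_mul_X_pow', semigroupHilbertSeries]
  simp only [PowerSeries.coeff_mk, ← mem_semigroup_and_not_sub_mem_iff hq hpq]
  have hstep : (p ≤ k ∧ ∃ u v : ℕ, u * p + v * q = k - p) → ∃ u v : ℕ, u * p + v * q = k := by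
    rintro ⟨hle, u, v, h⟩
    exact ⟨u + 1, v, by rw [Nat.succ_mul]; omega⟩
  by_cases h1 : p ≤ k <;> by_cases h2 : ∃ u v : ℕ, u * p + v * q = k - p <;>
    by_cases h3 : ∃ u v : ℕ, u * p + v * q = k <;> simp_all only [if_true, if_false] <;> simp_all

theorem coe_unitaryCyclotomic_eq_semigroupHilbertSeries_mul {p q : ℕ} (hp : IsPrimePow p)
    (hq : IsPrimePow q) (hpq : p.Coprime q) :
    (unitaryCyclotomic (p * q) : PowerSeries ℤ) =
      semigroupHilbertSeries p q * (1 - PowerSeries.X) := by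
  have hne : ∀ n : ℕ, 0 < n → (1 - PowerSeries.X ^ n : PowerSeries ℤ) ≠ 0 := fun n hn h => by
    have := congrArg PowerSeries.constantCoeff h
    simp [hn.ne'] at this
  have h1 := congrArg (fun f : ℤ[X] => (f : PowerSeries ℤ))
    (unitaryCyclotomic_primePow_mul hp hq hpq)
  simp only [coe_mul, coe_sub, coe_pow, coe_X, coe_one] at h1
  have h2 : semigroupHilbertSeries p q * (1 - PowerSeries.X ^ p) * (1 - PowerSeries.X ^ q) =
      1 - PowerSeries.X ^ (p * q) := by
    rw [semigroupHilbertSeries_mul_one_sub_X_pow hq.pos hpq, geom_sum_mul_neg, ← pow_mul,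
      mul_comm q p]
  refine mul_right_cancel₀ (mul_ne_zero (hne p hp.pos) (hne q hq.pos)) ?_
  linear_combination h1 - (1 - PowerSeries.X) * h2

open Classical in
/-- For coprime prime powers `p, q > 1` and `k ≥ 1`, the coefficient `a*_{pq}(k)` of `X^k`
in `Φ*_{pq}` is `1` if `k ∈ S(p,q)` and `k − 1 ∉ S(p,q)`, `−1` if `k ∉ S(p,q)` and
`k − 1 ∈ S(p,q)`, and `0` otherwise, where `S(p,q) = {up + vq : u, v ∈ ℕ}`. -/
theorem unitaryCyclotomic_coeff_semigroup (p q : ℕ)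
    (hp : IsPrimePow p) (hq : IsPrimePow q) (hpq : Nat.Coprime p q)
    (k : ℕ) (hk : 1 ≤ k) :
    (unitaryCyclotomic (p * q)).coeff k =
      if (∃ u v : ℕ, u * p + v * q = k) ∧ ¬ (∃ u v : ℕ, u * p + v * q = k - 1) then 1
      else if ¬ (∃ u v : ℕ, u * p + v * q = k) ∧ (∃ u v : ℕ, u * p + v * q = k - 1) then -1
      else 0 := by
  obtain ⟨n, rfl⟩ := Nat.exists_eq_add_of_le' hk
  rw [← coeff_coe, coe_unitaryCyclotomic_eq_semigroupHilbertSeries_mul hp hq hpq, mul_sub,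
    mul_one, map_sub, PowerSeries.coeff_succ_mul_X, semigroupHilbertSeries]
  simp only [PowerSeries.coeff_mk, Nat.add_sub_cancel]
  by_cases h1 : ∃ u v : ℕ, u * p + v * q = n + 1 <;>
    by_cases h2 : ∃ u v : ℕ, u * p + v * q = n <;> simp only [h1, h2] <;> simp
end

section
/- Let p and q be distinct primes and let S(p,q) = {up + vq : u, v ∈ ℕ}. For every k ≥ 1, the coefficient of X^k in the cyclotomic polynomial Φ_{pq} equals 1 if k ∈ S(p,q) and k − 1 ∉ S(p,q); equals −1 if k ∉ S(p,q) and k − 1 ∈ S(p,q); and equals 0 otherwise. In particular, all coefficients of Φ_{pq} lie in {−1, 0, 1}. -/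
open Polynomial

/-- Membership of `n` in the numerical semigroup generated by `p` and `q`. -/
def MemSemigroup (p q n : ℕ) : Prop := ∃ u v : ℕ, u * p + v * q = n

theorem MemSemigroup.add_left {p q n : ℕ} (h : MemSemigroup p q n) :
    MemSemigroup p q (p + n) := by
  obtain ⟨u, v, rfl⟩ := h
  exact ⟨u + 1, v, by ring⟩

/-- A coefficient of `q` in a representation can be taken smaller than `p`. -/
theorem MemSemigroup.exists_lt {p q n : ℕ} (hp : 0 < p) (h : MemSemigroup p q n) :
    ∃ u v : ℕ, v < p ∧ u * p + v * q = n := by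
  obtain ⟨u, v, rfl⟩ := h
  refine ⟨u + q * (v / p), v % p, Nat.mod_lt _ hp, ?_⟩
  conv_rhs => rw [← Nat.mod_add_div v p]
  ring

theorem not_memSemigroup_of_add_eq {p q n v : ℕ} (hpq : p.Coprime q) (hv : v < p)
    (h : p + n = v * q) : ¬ MemSemigroup p q n := by
  rintro ⟨u, w, rfl⟩
  have hw : w < v := by
    by_contra! hle
    have := Nat.mul_le_mul_right q hle
    have : 0 < p := by omega
    omega
  obtain ⟨d, rfl⟩ := Nat.exists_eq_add_of_lt hw
  have hd : (u + 1) * p = (d + 1) * q := by linarith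
  have := Nat.le_of_dvd (by omega) (hpq.dvd_of_dvd_mul_right (Dvd.intro_left _ hd))
  omega

open Classical in
/-- The generating function of the numerical semigroup generated by `p` and `q`. -/
noncomputable def semigroupSeries (p q : ℕ) : PowerSeries ℤ :=
  PowerSeries.mk fun n => if MemSemigroup p q n then 1 else 0

theorem one_sub_X_pow_mul_semigroupSeries {p q : ℕ} (hp : 0 < p) (hq : 0 < q)
    (hpq : p.Coprime q) :
    (1 - PowerSeries.X ^ p) * semigroupSeries p q =
      ∑ v ∈ Finset.range p, ((PowerSeries.X : PowerSeries ℤ) ^ q) ^ v := by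
  classical
  ext n
  have hR : PowerSeries.coeff n (∑ v ∈ Finset.range p, ((PowerSeries.X : PowerSeries ℤ) ^ q) ^ v)
      = if ∃ v < p, n = v * q then 1 else 0 := by
    simp only [map_sum, ← pow_mul, PowerSeries.coeff_X_pow]
    split_ifs with h
    · obtain ⟨v, hv, rfl⟩ := h
      rw [Finset.sum_eq_single v]
      · simp [mul_comm]
      · intro b _ hb
        rw [if_neg]
        intro he
        exact hb (Nat.eq_of_mul_eq_mul_left hq (by linarith))
      · intro hv'
        exact absurd (Finset.mem_range.2 hv) hv'
    · refine Finset.sum_eq_zero fun v hv => if_neg fun he => h ?_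
      exact ⟨v, Finset.mem_range.1 hv, by rw [he, mul_comm]⟩
  rw [hR, sub_mul, one_mul, map_sub, PowerSeries.coeff_X_pow_mul']
  simp only [semigroupSeries, PowerSeries.coeff_mk]
  by_cases h : ∃ v < p, n = v * q
  · rw [if_pos h]
    obtain ⟨v, hv, rfl⟩ := h
    rw [if_pos ⟨0, v, by simp⟩]
    split_ifs with h1 h2
    · exact absurd h2 (not_memSemigroup_of_add_eq hpq hv (Nat.add_sub_cancel' h1))
    all_goals simp
  · rw [if_neg h]
    by_cases hn : MemSemigroup p q n
    · obtain ⟨u, v, hv, rfl⟩ := hn.exists_lt hp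
      rcases u with _ | u
      · exact absurd ⟨v, hv, by simp⟩ h
      have he : (u + 1) * p + v * q = p + (u * p + v * q) := by ring
      have hm : MemSemigroup p q (u * p + v * q) := ⟨u, v, rfl⟩
      simp [he, hm, hm.add_left]
    · rw [if_neg hn, sub_eq_zero]
      split_ifs with h1 h2
      · have := h2.add_left
        rw [Nat.add_sub_cancel' h1] at this
        exact absurd this hn
      all_goals rfl

theorem cyclotomic_mul_primes_mul {p q : ℕ} (hp : p.Prime) (hq : q.Prime) (hpq : p ≠ q) :
    cyclotomic (p * q) ℤ * ((1 - X ^ p) * (1 - X ^ q)) = (1 - X) * (1 - X ^ (q * p)) := by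
  have := Fact.mk hp
  have h1 := cyclotomic_expand_eq_cyclotomic_mul hq
    (fun h => hpq ((Nat.prime_dvd_prime_iff_eq hq hp).1 h).symm) ℤ
  have h2 := cyclotomic_prime_mul_X_sub_one ℤ p
  have h3 := congrArg (expand ℤ q) h2
  simp only [map_mul, map_sub, map_one, map_pow, expand_X, ← pow_mul] at h3
  linear_combination (cyclotomic (p * q) ℤ * (1 - X ^ q)) * h2
    + (X - 1) * (X ^ q - 1) * (-h1) + (X - 1) * h3

theorem cyclotomic_eq_semigroupSeries {p q : ℕ} (hp : p.Prime) (hq : q.Prime) (hpq : p ≠ q) :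
    (cyclotomic (p * q) ℤ : PowerSeries ℤ) = (1 - PowerSeries.X) * semigroupSeries p q := by
  have h1 := congrArg (fun f : ℤ[X] => (f : PowerSeries ℤ)) (cyclotomic_mul_primes_mul hp hq hpq)
  simp only [Polynomial.coe_mul, Polynomial.coe_sub, Polynomial.coe_one, Polynomial.coe_pow,
    Polynomial.coe_X] at h1
  have h2 := one_sub_X_pow_mul_semigroupSeries hp.pos hq.pos ((Nat.coprime_primes hp hq).2 hpq)
  have h3 := geom_sum_mul ((PowerSeries.X : PowerSeries ℤ) ^ q) p
  have hne (m : ℕ) (hm : m ≠ 0) : (1 - PowerSeries.X ^ m : PowerSeries ℤ) ≠ 0 := fun h => by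
    simpa [hm] using congrArg PowerSeries.constantCoeff h
  refine mul_right_cancel₀ (mul_ne_zero (hne p hp.ne_zero) (hne q hq.ne_zero)) ?_
  rw [← h2, ← pow_mul] at h3
  linear_combination h1 + (1 - PowerSeries.X) * h3

open Classical in
theorem coeff_cyclotomic_eq_sub {p q k : ℕ} (hp : p.Prime) (hq : q.Prime) (hpq : p ≠ q)
    (hk : 1 ≤ k) :
    (cyclotomic (p * q) ℤ).coeff k =
      (if MemSemigroup p q k then 1 else 0) - (if MemSemigroup p q (k - 1) then 1 else 0) := by
  obtain ⟨k, rfl⟩ := Nat.exists_eq_add_of_le' hk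
  rw [← Polynomial.coeff_coe, cyclotomic_eq_semigroupSeries hp hq hpq, sub_mul, one_mul, map_sub,
    PowerSeries.coeff_succ_X_mul]
  simp [semigroupSeries]

open Classical in
/-- For distinct primes `p, q` and `k ≥ 1`, the coefficient of `X^k` in `Φ_{pq}` is `1` if
`k ∈ S(p,q)` and `k − 1 ∉ S(p,q)`, `−1` if `k ∉ S(p,q)` and `k − 1 ∈ S(p,q)`, and `0`
otherwise, where `S(p,q) = {up + vq : u, v ∈ ℕ}`. In particular all coefficients of
`Φ_{pq}` lie in `{−1, 0, 1}`. -/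
theorem cyclotomic_pq_coeff_semigroup (p q : ℕ)
    (hp : p.Prime) (hq : q.Prime) (hpq : p ≠ q) :
    (∀ k : ℕ, 1 ≤ k →
      (cyclotomic (p * q) ℤ).coeff k =
        if (∃ u v : ℕ, u * p + v * q = k) ∧ ¬ (∃ u v : ℕ, u * p + v * q = k - 1) then 1
        else if ¬ (∃ u v : ℕ, u * p + v * q = k) ∧ (∃ u v : ℕ, u * p + v * q = k - 1) then -1
        else 0) ∧
    ∀ j : ℕ, (cyclotomic (p * q) ℤ).coeff j ∈ ({-1, 0, 1} : Set ℤ) := by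
  refine ⟨fun k hk => ?_, fun j => ?_⟩
  · rw [coeff_cyclotomic_eq_sub hp hq hpq hk]
    change _ = if MemSemigroup p q k ∧ ¬ MemSemigroup p q (k - 1) then 1
      else if ¬ MemSemigroup p q k ∧ MemSemigroup p q (k - 1) then -1 else 0
    by_cases h1 : MemSemigroup p q k <;> by_cases h2 : MemSemigroup p q (k - 1) <;> simp [h1, h2]
  · rcases Nat.eq_zero_or_pos j with rfl | hj
    · simp [cyclotomic_coeff_zero ℤ (Nat.one_lt_mul_iff.2 ⟨hp.pos, hq.pos, Or.inl hp.one_lt⟩)]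
    · rw [coeff_cyclotomic_eq_sub hp hq hpq hj]
      split_ifs <;> simp
end

section
/- Let p, q, r ≥ 3 be pairwise coprime prime powers. Then the set C(Φ*_{pqr}) of coefficients of Φ*_{pqr} (i.e., the set of all integers occurring as the coefficient of X^j in Φ*_{pqr} for 0 ≤ j ≤ deg Φ*_{pqr}) is a set of consecutive integers: if s, t ∈ C(Φ*_{pqr}) and s ≤ u ≤ t for an integer u, then u ∈ C(Φ*_{pqr}). -/
open Polynomial

/-- The set of coefficients of a polynomial `f`, i.e. all values `f.coeff j` for
`0 ≤ j ≤ deg f`. -/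
def coeffSet (f : Polynomial ℤ) : Set ℤ := {c : ℤ | ∃ j ≤ f.natDegree, f.coeff j = c}

/-! ### Factorisation of unitary cyclotomic polynomials -/

theorem expand_prime_pow_cyclotomic {P d : ℕ} (hP : P.Prime) (hd : ¬ P ∣ d) (a : ℕ) :
    expand ℤ (P ^ a) (cyclotomic d ℤ) =
      (∏ i ∈ Finset.range a, cyclotomic (d * P ^ (i + 1)) ℤ) * cyclotomic d ℤ := by
  induction a with
  | zero => simp
  | succ a ih =>
    rw [pow_succ', ← expand_expand, ih, map_mul, map_prod,
      cyclotomic_expand_eq_cyclotomic_mul hP hd, ← mul_assoc, Finset.prod_range_succ', zero_add,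
      pow_one]
    congr 2
    refine Finset.prod_congr rfl fun i _ => ?_
    rw [cyclotomic_expand_eq_cyclotomic hP (Dvd.dvd.mul_left (dvd_pow_self P i.succ_ne_zero) d),
      mul_assoc, ← pow_succ]

theorem unitaryCyclotomic_mul_prime_pow_s14 {P m a : ℕ} (hP : P.Prime) (hm : m ≠ 0) (ha : a ≠ 0)
    (hPm : ¬ P ∣ m) :
    unitaryCyclotomic (m * P ^ a) * unitaryCyclotomic m =
      expand ℤ (P ^ a) (unitaryCyclotomic m) := by
  have hcop : ∀ {d i}, d ∣ m → d.Coprime (P ^ i) := fun {d i} hd =>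
    Nat.Coprime.pow_right i
      ((hP.coprime_iff_not_dvd.2 fun h => hPm (h.trans hd)).symm)
  have hpf : ∀ {d i}, d ∣ m → i ≠ 0 → (d * P ^ i).primeFactors = d.primeFactors ∪ {P} := by
    intro d i hd hi
    rw [(hcop hd).primeFactors_mul, Nat.primeFactors_prime_pow hi hP]
  have hnot : ∀ {d}, d ∣ m → P ∉ d.primeFactors := fun hd h =>
    hPm ((Nat.dvd_of_mem_primeFactors h).trans hd)
  have key : unitaryCyclotomic (m * P ^ a) =
      ∏ x ∈ (m.divisors.filter fun d => d.primeFactors = m.primeFactors) ×ˢ Finset.range a,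
        cyclotomic (x.1 * P ^ (x.2 + 1)) ℤ := by
    symm
    unfold unitaryCyclotomic
    refine Finset.prod_bij (fun x _ => x.1 * P ^ (x.2 + 1)) ?_ ?_ ?_ (fun _ _ => rfl)
    · rintro ⟨d, i⟩ hx
      simp only [Finset.mem_product, Finset.mem_filter, Nat.mem_divisors, Finset.mem_range] at hx ⊢
      obtain ⟨⟨⟨hd, -⟩, hdm⟩, hia⟩ := hx
      refine ⟨⟨mul_dvd_mul hd (pow_dvd_pow P hia), by have := hP.pos; positivity⟩, ?_⟩
      rw [hpf hd (by omega), hpf dvd_rfl ha, hdm]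
    · rintro ⟨d, i⟩ hx ⟨e, j⟩ hy h
      simp only [Finset.mem_product, Finset.mem_filter, Nat.mem_divisors, Finset.mem_range]
        at hx hy h
      have hde : d = e := Nat.dvd_antisymm
        ((hcop hx.1.1.1).dvd_of_dvd_mul_right (h ▸ dvd_mul_right d _))
        ((hcop hy.1.1.1).dvd_of_dvd_mul_right (h ▸ dvd_mul_right e _))
      subst hde
      have hd0 : 0 < d := Nat.pos_of_dvd_of_pos hx.1.1.1 (Nat.pos_of_ne_zero hm)
      rw [Nat.succ_injective (Nat.pow_right_injective hP.two_le (Nat.eq_of_mul_eq_mul_left hd0 h))]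
    · intro e he
      simp only [Finset.mem_filter, Nat.mem_divisors] at he
      obtain ⟨⟨hdvd, -⟩, hef⟩ := he
      obtain ⟨d, c, hd, hc, rfl⟩ := (Nat.dvd_mul).1 hdvd
      obtain ⟨i, hia, rfl⟩ := (Nat.dvd_prime_pow hP).1 hc
      have hi : i ≠ 0 := by
        rintro rfl
        rw [pow_zero, mul_one, hpf dvd_rfl ha] at hef
        exact hnot hd (hef ▸ by simp)
      rw [hpf hd hi, hpf dvd_rfl ha] at hef
      obtain ⟨i, rfl⟩ := Nat.exists_eq_succ_of_ne_zero hi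
      refine ⟨(d, i), ?_, rfl⟩
      simp only [Finset.mem_product, Finset.mem_filter, Nat.mem_divisors, Finset.mem_range]
      refine ⟨⟨⟨hd, hm⟩, ?_⟩, hia⟩
      refine Finset.Subset.antisymm (Nat.primeFactors_mono hd hm) fun l hl => ?_
      have h1 : l ∈ d.primeFactors ∪ {P} := hef ▸ Finset.mem_union_left _ hl
      rcases Finset.mem_union.1 h1 with h | h
      · exact h
      · rw [Finset.mem_singleton] at h
        exact absurd (h ▸ hl) (hnot dvd_rfl)
  rw [key, Finset.prod_product]
  unfold unitaryCyclotomic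
  rw [← Finset.prod_mul_distrib, map_prod]
  refine Finset.prod_congr rfl fun d hd => ?_
  rw [expand_prime_pow_cyclotomic hP]
  exact fun h => hPm (h.trans (Nat.dvd_of_mem_divisors (Finset.mem_filter.1 hd).1))

theorem unitaryCyclotomic_mul_isPrimePow {m p : ℕ} (hp : IsPrimePow p) (hm : m ≠ 0)
    (hmp : m.Coprime p) :
    unitaryCyclotomic (m * p) * unitaryCyclotomic m = expand ℤ p (unitaryCyclotomic m) := by
  obtain ⟨P, a, hP, ha, rfl⟩ := (isPrimePow_nat_iff _).1 hp
  refine unitaryCyclotomic_mul_prime_pow_s14 hP hm ha.ne' fun h => ?_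
  exact hP.one_lt.ne' (Nat.dvd_one.1 (hmp ▸ Nat.dvd_gcd h (dvd_pow_self P ha.ne')))

theorem unitaryCyclotomic_one : unitaryCyclotomic 1 = X - 1 := by
  simp [unitaryCyclotomic, Finset.filter_singleton]

theorem X_pow_sub_one_ne_zero {n : ℕ} (hn : n ≠ 0) : (X ^ n - 1 : ℤ[X]) ≠ 0 :=
  (monic_X_pow_sub_C (1 : ℤ) hn).ne_zero

theorem unitaryCyclotomic_ternary {p q r : ℕ}
    (hp : IsPrimePow p) (hq : IsPrimePow q) (hr : IsPrimePow r)
    (hpq : p.Coprime q) (hpr : p.Coprime r) (hqr : q.Coprime r) :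
    unitaryCyclotomic (p * q * r) *
      ((X - 1) * (X ^ (p * q) - 1) * (X ^ (p * r) - 1) * (X ^ (q * r) - 1)) =
      (X ^ (p * q * r) - 1) * (X ^ p - 1) * (X ^ q - 1) * (X ^ r - 1) := by
  have h1 := unitaryCyclotomic_mul_isPrimePow hp one_ne_zero (Nat.coprime_one_left p)
  have h2 := unitaryCyclotomic_mul_isPrimePow hq hp.ne_zero hpq
  have h3 := unitaryCyclotomic_mul_isPrimePow hr (mul_ne_zero hp.ne_zero hq.ne_zero)
    (Nat.Coprime.mul_left hpr hqr)
  rw [one_mul, unitaryCyclotomic_one] at h1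
  have h1' := congrArg (expand ℤ q) h1
  simp only [map_mul, map_sub, map_one, expand_X, map_pow, ← pow_mul] at h1 h1'
  have h4 : unitaryCyclotomic (p * q) * ((X ^ p - 1) * (X ^ q - 1)) =
      (X ^ (q * p) - 1) * (X - 1) := by
    linear_combination (unitaryCyclotomic (p * q)) * (-(X ^ q - 1)) * h1
      + (X ^ q - 1) * (X - 1) * h2 + (X - 1) * h1'
  have h4' := congrArg (expand ℤ r) h4
  simp only [map_mul, map_sub, map_one, expand_X, map_pow, ← pow_mul] at h4'
  have hne : unitaryCyclotomic (p * q) ≠ 0 := by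
    intro h0
    rw [h0, zero_mul] at h4
    refine mul_ne_zero (X_pow_sub_one_ne_zero (mul_ne_zero hq.ne_zero hp.ne_zero)) ?_ h4.symm
    simpa using X_pow_sub_one_ne_zero one_ne_zero
  refine mul_left_cancel₀ hne ?_
  linear_combination ((X - 1) * (X ^ (p * q) - 1) * (X ^ (p * r) - 1) * (X ^ (q * r) - 1)) * h3
    + (X - 1) * (X ^ (p * q) - 1) * h4' - (X ^ (p * q * r) - 1) * (X ^ r - 1) * h4

/-! ### Coefficients of the quotient -/

theorem coeff_sum_X_pow_of_injOn {ι : Type*} (T : Finset ι) (e : ι → ℕ)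
    (he : Set.InjOn e T) (n : ℕ) [Decidable (∃ t ∈ T, e t = n)] :
    (∑ t ∈ T, (X : ℤ[X]) ^ e t).coeff n = if ∃ t ∈ T, e t = n then 1 else 0 := by
  classical
  simp only [finsetSum_coeff, coeff_X_pow]
  split_ifs with h
  · obtain ⟨t, ht, rfl⟩ := h
    rw [Finset.sum_eq_single_of_mem t ht]
    · simp
    · intro b hb hbt
      rw [if_neg fun h => hbt (he hb ht h.symm)]
  · refine Finset.sum_eq_zero fun t ht => if_neg fun h' => h ⟨t, ht, h'.symm⟩

theorem mixedRadix_unique {p q r x y K x' y' K' : ℤ} (hpq : IsCoprime p q) (hpr : IsCoprime p r)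
    (hqr : IsCoprime q r) (hx : |x - x'| < r) (hy : |y - y'| < q)
    (h : p * (x * q + y * r) + K * (q * r) = p * (x' * q + y' * r) + K' * (q * r)) :
    x = x' ∧ y = y' ∧ K = K' := by
  have h1 : r ∣ (p * q) * (x - x') :=
    ⟨p * (y' - y) + (K' - K) * q, by linear_combination h⟩
  have h2 : q ∣ (p * r) * (y - y') :=
    ⟨p * (x' - x) + (K' - K) * r, by linear_combination h⟩
  have hxx := Int.eq_zero_of_abs_lt_dvd ((hpr.mul_left hqr).symm.dvd_of_dvd_mul_left h1) hx
  have hyy := Int.eq_zero_of_abs_lt_dvd ((hpq.mul_left hqr.symm).symm.dvd_of_dvd_mul_left h2) hy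
  obtain rfl := sub_eq_zero.1 hxx
  obtain rfl := sub_eq_zero.1 hyy
  refine ⟨rfl, rfl, mul_right_cancel₀ (b := q * r) ?_ (by linarith)⟩
  exact mul_ne_zero ((abs_nonneg _).trans_lt hy).ne' ((abs_nonneg _).trans_lt hx).ne'

theorem IsCoprime.exists_dvd_sub_mul {a m : ℤ} (hm : 0 < m) (h : IsCoprime a m) (N : ℤ) :
    ∃ x, 0 ≤ x ∧ x < m ∧ m ∣ N - a * x := by
  obtain ⟨u, v, huv⟩ := h
  refine ⟨(N * u) % m, Int.emod_nonneg _ hm.ne', Int.emod_lt_of_pos _ hm,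
    N * v + a * (N * u / m), ?_⟩
  have := Int.emod_add_mul_ediv (N * u) m
  linear_combination (-N) * huv - a * this

theorem exists_mixedRadix {p q r : ℤ} (hq : 0 < q) (hr : 0 < r) (hpq : IsCoprime p q)
    (hpr : IsCoprime p r) (hqr : IsCoprime q r) (N : ℤ) :
    ∃ x y K, 0 ≤ x ∧ x < r ∧ 0 ≤ y ∧ y < q ∧ N = p * (x * q + y * r) + K * (q * r) := by
  obtain ⟨x, hx0, hxr, c, hc⟩ := (hpr.mul_left hqr).exists_dvd_sub_mul hr N
  obtain ⟨y, hy0, hyq, d, hd⟩ := (hpq.mul_left hqr.symm).exists_dvd_sub_mul hq N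
  obtain ⟨K, hK⟩ : q * r ∣ N - p * (x * q + y * r) :=
    hqr.mul_dvd ⟨d - p * x, by linear_combination hd⟩ ⟨c - p * y, by linear_combination hc⟩
  exact ⟨x, y, K, hx0, hxr, hy0, hyq, by linear_combination hK⟩

/-- The sum of `X ^ (k q r + p (q i + r j) + s)` over `k < p`, `i < m`, `j < l`. -/
noncomputable def boxSum (p q r m l s : ℕ) : ℤ[X] :=
  ∑ t ∈ Finset.range p ×ˢ Finset.range m ×ˢ Finset.range l,
    X ^ (t.1 * (q * r) + p * (q * t.2.1 + r * t.2.2) + s)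

theorem boxSum_mul_X_pow (p q r m l s t : ℕ) :
    boxSum p q r m l s * X ^ t = boxSum p q r m l (s + t) := by
  simp only [boxSum, Finset.sum_mul, ← pow_add, add_assoc]

theorem boxSum_mul (p q r m l s : ℕ) :
    boxSum p q r m l s * ((X ^ (q * r) - 1) * (X ^ (p * q) - 1) * (X ^ (p * r) - 1)) =
      X ^ s * (X ^ (p * q * r) - 1) * (X ^ (p * q * m) - 1) * (X ^ (p * r * l) - 1) := by
  have h : boxSum p q r m l s = X ^ s * ((∑ k ∈ Finset.range p, (X ^ (q * r)) ^ k) *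
      ((∑ i ∈ Finset.range m, (X ^ (p * q)) ^ i) * ∑ j ∈ Finset.range l, (X ^ (p * r)) ^ j)) := by
    rw [Finset.sum_mul_sum, ← Finset.sum_product', Finset.sum_mul_sum, ← Finset.sum_product',
      Finset.mul_sum, boxSum]
    refine Finset.sum_congr rfl fun t _ => ?_
    ring
  have h1 := geom_sum_mul (X ^ (q * r) : ℤ[X]) p
  have h2 := geom_sum_mul (X ^ (p * q) : ℤ[X]) m
  have h3 := geom_sum_mul (X ^ (p * r) : ℤ[X]) l
  rw [← pow_mul] at h1 h2 h3
  rw [show p * q * r = q * r * p by ring, ← h1, ← h2, ← h3, h]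
  ring

theorem coeff_boxSum {p q r m l s n : ℕ} {x y K : ℤ} (hpq : p.Coprime q) (hpr : p.Coprime r)
    (hqr : q.Coprime r) (hx : (m : ℤ) - r ≤ x) (hxr : x < r) (hy : (l : ℤ) - q ≤ y) (hyq : y < q)
    (hm : m ≤ r) (hl : l ≤ q)
    (hn : (n : ℤ) - s = p * (x * q + y * r) + K * (q * r)) :
    (boxSum p q r m l s).coeff n =
      if (0 ≤ x ∧ x < m) ∧ (0 ≤ y ∧ y < l) ∧ 0 ≤ K ∧ K < p then 1 else 0 := by
  classical
  have hpq' := Nat.isCoprime_iff_coprime.2 hpq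
  have hpr' := Nat.isCoprime_iff_coprime.2 hpr
  have hqr' := Nat.isCoprime_iff_coprime.2 hqr
  rw [boxSum, coeff_sum_X_pow_of_injOn]
  · refine if_congr ⟨?_, ?_⟩ rfl rfl
    · rintro ⟨⟨k, i, j⟩, ht, rfl⟩
      simp only [Finset.mem_product, Finset.mem_range] at ht
      push_cast at hn
      obtain ⟨h1, h2, h3⟩ := mixedRadix_unique (x := x) (x' := i) (y := y) (y' := j) (K := K)
        (K' := k) hpq' hpr' hqr' (by rw [abs_lt]; omega) (by rw [abs_lt]; omega)
        (by linear_combination -hn)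
      omega
    · rintro ⟨⟨hx0, hxm⟩, ⟨hy0, hyl⟩, hK0, hKp⟩
      lift x to ℕ using hx0
      lift y to ℕ using hy0
      lift K to ℕ using hK0
      refine ⟨(K, x, y), ?_, ?_⟩
      · simp only [Finset.mem_product, Finset.mem_range]
        omega
      · zify
        linear_combination -hn
  · rintro ⟨k, i, j⟩ ht ⟨k', i', j'⟩ ht' h
    simp only [Finset.coe_product, Set.mem_prod, Finset.coe_range, Set.mem_Iio] at ht ht' h
    zify at h
    obtain ⟨h1, h2, h3⟩ := mixedRadix_unique (x := i) (x' := i') (y := j) (y' := j') (K := k)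
      (K' := k') hpq' hpr' hqr' (by rw [abs_lt]; omega) (by rw [abs_lt]; omega)
      (by linear_combination h)
    simp only [Nat.cast_inj] at h1 h2 h3
    rw [h1, h2, h3]

/-! ### Bounding the second difference -/

theorem abs_indicator_second_difference_le (l p K u v : ℤ) (h : |u| + |v| ≤ p) :
    |(if l ≤ K ∧ K < l + p then (1 : ℤ) else 0) - (if l ≤ K + u ∧ K + u < l + p then 1 else 0)
      - (if l ≤ K + v ∧ K + v < l + p then 1 else 0)
      + (if l ≤ K + u + v ∧ K + u + v < l + p then 1 else 0)| ≤ 1 := by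
  rw [abs_le]
  rcases abs_cases u with ⟨hu, _⟩ | ⟨hu, _⟩ <;> rcases abs_cases v with ⟨hv, _⟩ | ⟨hv, _⟩ <;>
    rw [hu, hv] at h <;> split_ifs <;> omega

theorem abs_add_abs_carry_le {p q r u v d e A B : ℤ} (hp : 1 ≤ p) (hq : 2 ≤ q) (hr : 2 ≤ r)
    (hu : p * d = 1 + r * u) (hv : p * e = 1 + q * v) (hd : |d| ≤ A) (he : |e| ≤ B)
    (hAB : q * A + r * B ≤ q * r + 1 - q - r) : |u| + |v| ≤ p := by
  have hu' : r * |u| ≤ p * A + 1 := by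
    rw [← abs_of_nonneg (show 0 ≤ r by linarith), ← abs_mul,
      show r * u = p * d - 1 by linarith]
    have h1 := abs_sub (p * d) 1
    rw [abs_mul, abs_of_nonneg (show 0 ≤ p by linarith), abs_one] at h1
    nlinarith
  have hv' : q * |v| ≤ p * B + 1 := by
    rw [← abs_of_nonneg (show 0 ≤ q by linarith), ← abs_mul,
      show q * v = p * e - 1 by linarith]
    have h1 := abs_sub (p * e) 1
    rw [abs_mul, abs_of_nonneg (show 0 ≤ p by linarith), abs_one] at h1
    nlinarith
  by_contra! hlt
  have h1 : q * r * (p + 1) ≤ q * r * (|u| + |v|) :=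
    mul_le_mul_of_nonneg_left (by linarith) (by positivity)
  have h2 : q * (r * |u|) ≤ q * (p * A + 1) := mul_le_mul_of_nonneg_left hu' (by linarith)
  have h3 : r * (q * |v|) ≤ r * (p * B + 1) := mul_le_mul_of_nonneg_left hv' (by linarith)
  have h4 : p * (q * A + r * B) ≤ p * (q * r + 1 - q - r) :=
    mul_le_mul_of_nonneg_left hAB (by linarith)
  have h5 : 1 * (q + r - 1) ≤ p * (q + r - 1) := mul_le_mul_of_nonneg_right hp (by linarith)
  nlinarith

/-- The coefficient with mixed radix digits `x`, `y` and carry `K`. -/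
def digitCoeff (p μ l x y K : ℤ) : ℤ :=
  (if x < μ ∧ y < l ∧ 0 ≤ K ∧ K < p then 1 else 0)
    - (if ¬ x < μ ∧ ¬ y < l ∧ -p ≤ K ∧ K < 0 then 1 else 0)

theorem abs_digitCoeff_second_difference_le {p q r μ l x y x' y' K u v : ℤ} (hp : 1 ≤ p)
    (hq : 2 ≤ q) (hr : 2 ≤ r) (hμl : q * μ + r * l = q * r + 1)
    (hx : 0 ≤ x) (hxr : x < r) (hy : 0 ≤ y) (hyq : y < q)
    (hx' : 0 ≤ x') (hxr' : x' < r) (hy' : 0 ≤ y') (hyq' : y' < q)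
    (hu : p * (x - x') = 1 + r * u) (hv : p * (y - y') = 1 + q * v) :
    |digitCoeff p μ l x y K - digitCoeff p μ l x' y (K + u) - digitCoeff p μ l x y' (K + v)
      + digitCoeff p μ l x' y' (K + u + v)| ≤ 1 := by
  have small : x < μ → x' < μ → y < l → y' < l → |u| + |v| ≤ p := fun h1 h2 h3 h4 =>
    abs_add_abs_carry_le (A := μ - 1) (B := l - 1) hp hq hr hu hv
      (by rw [abs_le]; omega) (by rw [abs_le]; omega) (by linarith)
  have large : μ ≤ x → μ ≤ x' → l ≤ y → l ≤ y' → |u| + |v| ≤ p := fun h1 h2 h3 h4 =>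
    abs_add_abs_carry_le (A := r - 1 - μ) (B := q - 1 - l) hp hq hr hu hv
      (by rw [abs_le]; omega) (by rw [abs_le]; omega) (by linarith)
  unfold digitCoeff
  rcases em (x < μ) with h1 | h1 <;> rcases em (x' < μ) with h2 | h2 <;> rcases em (y < l) with h3 | h3 <;>
  rcases em (y' < l) with h4 | h4 <;>
  simp only [h1, h2, h3, h4, not_true, not_false_iff, true_and, false_and, and_false, if_false,
    sub_zero, zero_sub]
  case inl.inl.inl.inl =>
    simpa using abs_indicator_second_difference_le 0 p K u v (small h1 h2 h3 h4)
  case inr.inr.inr.inr =>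
    rw [← abs_neg]
    convert abs_indicator_second_difference_le (-p) p K u v (large (not_lt.1 h1) (not_lt.1 h2)
      (not_lt.1 h3) (not_lt.1 h4)) using 2
    simp only [neg_add_cancel]
    ring
  all_goals
    rw [abs_le]
    constructor <;> (try split_ifs) <;> norm_num

theorem exists_mul_add_mul_eq {q r : ℕ} (hq : 2 ≤ q) (hr : 2 ≤ r) (hqr : q.Coprime r) :
    ∃ μ l : ℕ, μ ≤ r ∧ l ≤ q ∧ q * μ + r * l = q * r + 1 := by
  obtain ⟨μ, hμr, hμ⟩ := Nat.exists_mul_mod_eq_one_of_coprime hqr (by omega)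
  have h := Nat.mod_add_div (q * μ) r
  rw [hμ] at h
  have hle : q * μ / r ≤ q := by
    by_contra! hlt
    nlinarith
  refine ⟨μ, q - q * μ / r, hμr.le, Nat.sub_le _ _, ?_⟩
  zify [hle] at h ⊢
  linear_combination -h

/-! ### Consecutive coefficients -/

theorem natDegree_X_pow_sub_one (n : ℕ) : (X ^ n - 1 : ℤ[X]).natDegree = n := by
  simpa using natDegree_X_pow_sub_C (n := n) (r := (1 : ℤ))

section Ternary

variable {p q r : ℕ} {F : ℤ[X]}

theorem natDegree_lt_of_ternary_eq (hp : 2 ≤ p) (hq : 2 ≤ q) (hr : 2 ≤ r)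
    (hF : F * ((X - 1) * (X ^ (p * q) - 1) * (X ^ (p * r) - 1) * (X ^ (q * r) - 1)) =
      (X ^ (p * q * r) - 1) * (X ^ p - 1) * (X ^ q - 1) * (X ^ r - 1)) :
    F.natDegree < p * q * r := by
  have hX : (X - 1 : ℤ[X]) = X ^ 1 - 1 := by rw [pow_one]
  rw [hX] at hF
  have n1 := X_pow_sub_one_ne_zero one_ne_zero
  have n2 := X_pow_sub_one_ne_zero (show p * q ≠ 0 by positivity)
  have n3 := X_pow_sub_one_ne_zero (show p * r ≠ 0 by positivity)
  have n4 := X_pow_sub_one_ne_zero (show q * r ≠ 0 by positivity)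
  have n5 := X_pow_sub_one_ne_zero (show p * q * r ≠ 0 by positivity)
  have n6 := X_pow_sub_one_ne_zero (show p ≠ 0 by positivity)
  have n7 := X_pow_sub_one_ne_zero (show q ≠ 0 by positivity)
  have n8 := X_pow_sub_one_ne_zero (show r ≠ 0 by positivity)
  have hF0 : F ≠ 0 := by
    rintro rfl
    rw [zero_mul] at hF
    exact mul_ne_zero (mul_ne_zero (mul_ne_zero n5 n6) n7) n8 hF.symm
  have h := congrArg natDegree hF
  rw [natDegree_mul hF0 (mul_ne_zero (mul_ne_zero (mul_ne_zero n1 n2) n3) n4),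
    natDegree_mul (mul_ne_zero (mul_ne_zero n1 n2) n3) n4, natDegree_mul (mul_ne_zero n1 n2) n3,
    natDegree_mul n1 n2, natDegree_mul (mul_ne_zero (mul_ne_zero n5 n6) n7) n8,
    natDegree_mul (mul_ne_zero n5 n6) n7, natDegree_mul n5 n6] at h
  simp only [natDegree_X_pow_sub_one] at h
  nlinarith

theorem ternary_mul_eq_boxSum {μ l : ℕ} (hp : p ≠ 0) (hq : q ≠ 0) (hr : r ≠ 0) (hμ : μ ≤ r)
    (hl : l ≤ q) (hμl : q * μ + r * l = q * r + 1)
    (hF : F * ((X - 1) * (X ^ (p * q) - 1) * (X ^ (p * r) - 1) * (X ^ (q * r) - 1)) =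
      (X ^ (p * q * r) - 1) * (X ^ p - 1) * (X ^ q - 1) * (X ^ r - 1)) :
    F * (X - 1) * (X ^ (p * q * r) - 1) =
      (boxSum p q r μ l 0 - boxSum p q r (r - μ) (q - l) p) * ((X ^ q - 1) * (X ^ r - 1)) := by
  have h1 := boxSum_mul p q r μ l 0
  have h2 := boxSum_mul p q r (r - μ) (q - l) p
  have hm : r = μ + (r - μ) := by omega
  have hk : q = l + (q - l) := by omega
  generalize r - μ = m at *
  generalize q - l = k at *
  zify at hm hk hμl
  have e1 : (X ^ (p * q * μ) * X ^ (p * r * l) : ℤ[X]) = X ^ p * X ^ (p * q * r) := by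
    rw [← pow_add, ← pow_add]
    congr 1
    zify
    linear_combination p * hμl
  have e2 : (X ^ p * X ^ (p * q * m) : ℤ[X]) = X ^ (p * r * l) := by
    rw [← pow_add]
    congr 1
    zify
    linear_combination (-p : ℤ) * hμl - p * q * hm
  have e3 : (X ^ p * X ^ (p * r * k) : ℤ[X]) = X ^ (p * q * μ) := by
    rw [← pow_add]
    congr 1
    zify
    linear_combination (-p : ℤ) * hμl - p * r * hk
  have e4 : (X ^ p * X ^ (p * q * m) * X ^ (p * r * k) : ℤ[X]) = X ^ (p * q * r) := by
    rw [e2, ← pow_add]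
    congr 1
    zify
    linear_combination (-p : ℤ) * r * hk
  refine mul_right_cancel₀ (mul_ne_zero (mul_ne_zero (X_pow_sub_one_ne_zero (mul_ne_zero hq hr))
    (X_pow_sub_one_ne_zero (mul_ne_zero hp hq))) (X_pow_sub_one_ne_zero (mul_ne_zero hp hr))) ?_
  linear_combination (X ^ (p * q * r) - 1) * hF - (X ^ q - 1) * (X ^ r - 1) * (h1 - h2) +
    (X ^ q - 1) * (X ^ r - 1) * (X ^ (p * q * r) - 1) * (e4 - e1 - e2 - e3)

theorem abs_coeff_succ_sub_coeff_le (hp : 2 ≤ p) (hq : 2 ≤ q) (hr : 2 ≤ r)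
    (hpq : p.Coprime q) (hpr : p.Coprime r) (hqr : q.Coprime r)
    (hF : F * ((X - 1) * (X ^ (p * q) - 1) * (X ^ (p * r) - 1) * (X ^ (q * r) - 1)) =
      (X ^ (p * q * r) - 1) * (X ^ p - 1) * (X ^ q - 1) * (X ^ r - 1))
    {n : ℕ} (hn : n + 1 < p * q * r) : |F.coeff (n + 1) - F.coeff n| ≤ 1 := by
  obtain ⟨μ, l, hμ, hl, hμl⟩ := exists_mul_add_mul_eq hq hr hqr
  have hpq' := Nat.isCoprime_iff_coprime.2 hpq
  have hpr' := Nat.isCoprime_iff_coprime.2 hpr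
  have hqr' := Nat.isCoprime_iff_coprime.2 hqr
  have hμl' : (q : ℤ) * μ + r * l = q * r + 1 := mod_cast hμl
  have value : ∀ (s : ℕ) (x y K : ℤ), 0 ≤ x → x < r → 0 ≤ y → y < q →
      ((n + 1 : ℕ) : ℤ) - s = p * (x * q + y * r) + K * (q * r) →
      (boxSum p q r μ l s).coeff (n + 1) - (boxSum p q r (r - μ) (q - l) (p + s)).coeff (n + 1) =
        digitCoeff p μ l x y K := by
    intro s x y K hx hxr hy hyq h
    rw [coeff_boxSum hpq hpr hqr (by omega) hxr (by omega) hyq hμ hl h,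
      coeff_boxSum (x := x - μ) (y := y - l) (K := K + p) hpq hpr hqr (by omega) (by omega)
        (by omega) (by omega) (Nat.sub_le _ _) (Nat.sub_le _ _) (by
          push_cast at h ⊢
          linear_combination h + p * hμl'), digitCoeff]
    congr 1 <;> refine if_congr ?_ rfl rfl <;> omega
  obtain ⟨x, y, K, hx, hxr, hy, hyq, hN⟩ := exists_mixedRadix (p := p) (q := q) (r := r)
    (by omega) (by omega) hpq' hpr' hqr' ((n + 1 : ℕ) : ℤ)
  obtain ⟨x', hx', hxr', u, hu⟩ := hpr'.exists_dvd_sub_mul (by omega) (p * x - 1)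
  obtain ⟨y', hy', hyq', v, hv⟩ := hpq'.exists_dvd_sub_mul (by omega) (p * y - 1)
  have key := abs_digitCoeff_second_difference_le (p := p) (K := K) (by omega) (by omega) (by omega)
    hμl' hx hxr hy hyq hx' hxr' hy' hyq' (u := u) (v := v) (by linear_combination hu)
    (by linear_combination hv)
  rw [← value 0 x y K hx hxr hy hyq (by push_cast at hN ⊢; linear_combination hN),
    ← value q x' y (K + u) hx' hxr' hy hyq (by
      push_cast at hN ⊢; linear_combination hN + q * hu),
    ← value r x y' (K + v) hx hxr hy' hyq' (by
      push_cast at hN ⊢; linear_combination hN + r * hv),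
    ← value (q + r) x' y' (K + u + v) hx' hxr' hy' hyq' (by
      push_cast at hN ⊢; linear_combination hN + q * hu + r * hv)] at key
  have h := ternary_mul_eq_boxSum (by omega) (by omega) (by omega) hμ hl hμl hF
  have hexp : (boxSum p q r μ l 0 - boxSum p q r (r - μ) (q - l) p) *
      ((X ^ q - 1) * (X ^ r - 1)) =
      (boxSum p q r μ l 0 - boxSum p q r (r - μ) (q - l) (p + 0))
      - (boxSum p q r μ l q - boxSum p q r (r - μ) (q - l) (p + q))
      - (boxSum p q r μ l r - boxSum p q r (r - μ) (q - l) (p + r))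
      + (boxSum p q r μ l (q + r) - boxSum p q r (r - μ) (q - l) (p + (q + r))) := by
    have e (m l s t : ℕ) := (boxSum_mul_X_pow p q r m l s t).symm
    have z (t : ℕ) : boxSum p q r μ l t = boxSum p q r μ l 0 * X ^ t := by
      rw [boxSum_mul_X_pow, zero_add]
    rw [z q, z r, z (q + r), add_zero, e _ _ p q, e _ _ p r, e _ _ p (q + r)]
    ring
  have hc := congrArg (coeff · (n + 1)) (h.trans hexp)
  simp only [coeff_add, coeff_sub, mul_sub, mul_one, coeff_mul_X, coeff_mul_X_pow',
    if_neg hn.not_ge] at hc key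
  rwa [← hc, zero_sub, neg_sub] at key

end Ternary

theorem exists_eq_of_abs_succ_sub_le_one {f : ℕ → ℤ} {d : ℕ}
    (hf : ∀ n, n + 1 ≤ d → |f (n + 1) - f n| ≤ 1) {i j : ℕ} (hi : i ≤ d) (hj : j ≤ d) {u : ℤ}
    (hiu : f i ≤ u) (huj : u ≤ f j) : ∃ k ≤ d, f k = u := by
  by_contra! hne
  have side : ∀ n ≤ d, (f n < u ↔ f 0 < u) := by
    intro n hn
    induction n with
    | zero => rfl
    | succ n ih =>
      rw [← ih (by omega)]
      have h1 := abs_le.1 (hf n hn)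
      have h2 := hne n (by omega)
      have h3 := hne (n + 1) hn
      omega
  have h1 := side i hi
  have h2 := side j hj
  have h3 := hne i hi
  omega

/-- For pairwise coprime prime powers `p, q, r ≥ 3`, the set of coefficients of
`Φ*_{pqr}` consists of consecutive integers. -/
theorem coeffSet_unitaryCyclotomic_consecutive (p q r : ℕ)
    (hp : IsPrimePow p) (hq : IsPrimePow q) (hr : IsPrimePow r)
    (hp3 : 3 ≤ p) (hq3 : 3 ≤ q) (hr3 : 3 ≤ r)
    (hpq : Nat.Coprime p q) (hpr : Nat.Coprime p r) (hqr : Nat.Coprime q r) :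
    ∀ s t u : ℤ, s ∈ coeffSet (unitaryCyclotomic (p * q * r)) →
      t ∈ coeffSet (unitaryCyclotomic (p * q * r)) →
      s ≤ u → u ≤ t → u ∈ coeffSet (unitaryCyclotomic (p * q * r)) := by
  rintro s t u ⟨i, hi, rfl⟩ ⟨j, hj, rfl⟩ hs ht
  have hF := unitaryCyclotomic_ternary hp hq hr hpq hpr hqr
  have hdeg := natDegree_lt_of_ternary_eq (by omega) (by omega) (by omega) hF
  exact exists_eq_of_abs_succ_sub_le_one (fun n hn => abs_coeff_succ_sub_coeff_le (by omega)
    (by omega) (by omega) hpq hpr hqr hF (by omega)) hi hj hs ht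
end
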